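/- arXiv:gr-qc/9508065 — 11 statements merged into one kernel-verified Lean document; each statement's English description precedes it below -/
import Mathlib

section
/- Suppose f is a C² real-valued function on an interval [a, b) with the property that there is a number ε > 0 such that f(x)f'(x) > 0 for all a < x < a + ε. If there are continuous functions p, q and r on (a, b) such that p(x)r(x) > 0 for all x ∈ (a, b) and p(x)f''(x) = q(x)f'(x) + r(x)f(x) on (a, b), then f is strictly monotone on [a, b); in particular, f(x) has the same constant nonzero sign on (a, b) that it has on (a, a + ε). -/
lemma sign_aux (a b : ℝ) (h : ℝ → ℝ) (hc : ContinuousOn h (Set.Ioo a b))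
    (h0 : ∀ x ∈ Set.Ioo a b, h x ≠ 0) :
    ∀ x ∈ Set.Ioo a b, ∀ y ∈ Set.Ioo a b, 0 < h x * h y := by
  intro x hx y hy
  by_contra hn
  have hsub : Set.uIcc x y ⊆ Set.Ioo a b := Set.OrdConnected.uIcc_subset inferInstance hx hy
  have h1 : (0:ℝ) ∈ Set.uIcc (h x) (h y) := by
    rw [Set.mem_uIcc]
    rcases le_total (h x) 0 with h2 | h2 <;> rcases le_total (h y) 0 with h3 | h3
    · exact absurd (mul_pos_of_neg_of_neg (lt_of_le_of_ne h2 (h0 x hx))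
        (lt_of_le_of_ne h3 (h0 y hy))) hn
    · exact Or.inl ⟨h2, h3⟩
    · exact Or.inr ⟨h3, h2⟩
    · exact absurd (mul_pos (lt_of_le_of_ne h2 (h0 x hx).symm)
        (lt_of_le_of_ne h3 (h0 y hy).symm)) hn
  obtain ⟨z, hz, hz0⟩ := intermediate_value_uIcc (hc.mono hsub) h1
  exact h0 z (hsub hz) hz0

/-- Monotonicity lemma: if `f` is `C²` on `[a,b)` with `f·f' > 0` just to the right of `a`,
and `f` satisfies a second-order linear ODE `p f'' = q f' + r f` on `(a,b)` with
`p·r > 0` there, then `f` is strictly monotone on `[a,b)`; in particular `f` has the same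
constant nonzero sign on `(a,b)` that it has on `(a, a+ε)`. -/
theorem stmt_1 (a b ε : ℝ) (hab : a < b) (hε : 0 < ε) (hεb : a + ε ≤ b)
    (f p q r : ℝ → ℝ)
    (hf : ContDiffOn ℝ 2 f (Set.Ico a b))
    (hsign : ∀ x, a < x → x < a + ε → f x * deriv f x > 0)
    (hp : ContinuousOn p (Set.Ioo a b))
    (hq : ContinuousOn q (Set.Ioo a b))
    (hr : ContinuousOn r (Set.Ioo a b))
    (hpr : ∀ x ∈ Set.Ioo a b, p x * r x > 0)
    (hode : ∀ x ∈ Set.Ioo a b, p x * deriv (deriv f) x = q x * deriv f x + r x * f x) :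
    (StrictMonoOn f (Set.Ico a b) ∨ StrictAntiOn f (Set.Ico a b)) ∧
      ∀ x ∈ Set.Ioo a b, ∀ y ∈ Set.Ioo a (a + ε), f x * f y > 0 := by
  have hfo : ContDiffOn ℝ 2 f (Set.Ioo a b) := hf.mono Set.Ioo_subset_Ico_self
  have hd1 : ∀ x ∈ Set.Ioo a b, HasDerivAt f (deriv f x) x := fun x hx =>
    ((hfo.differentiableOn (by norm_num)).differentiableAt (isOpen_Ioo.mem_nhds hx)).hasDerivAt
  have hfo' : ContDiffOn ℝ 1 (deriv f) (Set.Ioo a b) :=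
    hfo.deriv_of_isOpen isOpen_Ioo (by norm_num)
  have hd2 : ∀ x ∈ Set.Ioo a b, HasDerivAt (deriv f) (deriv (deriv f) x) x := fun x hx =>
    ((hfo'.differentiableOn (by norm_num)).differentiableAt (isOpen_Ioo.mem_nhds hx)).hasDerivAt
  have hcf : ContinuousOn f (Set.Ioo a b) := hfo.continuousOn
  have hcf' : ContinuousOn (deriv f) (Set.Ioo a b) := hfo'.continuousOn
  have hcg : ContinuousOn (fun x => f x * deriv f x) (Set.Ioo a b) := hcf.mul hcf'
  have hg : ∀ x ∈ Set.Ioo a b, 0 < f x * deriv f x := by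
    intro c hc
    by_contra hn
    have hn' : f c * deriv f c ≤ 0 := not_lt.mp hn
    have hcε : a + ε ≤ c := by
      by_contra h
      exact hn (hsign c hc.1 (not_le.mp h))
    set m := a + ε / 2 with hm
    have hma : a < m := by linarith
    have hmc : m < c := by linarith
    have hsub : Set.Icc m c ⊆ Set.Ioo a b := fun x hx =>
      ⟨lt_of_lt_of_le hma hx.1, lt_of_le_of_lt hx.2 hc.2⟩
    have hgm : 0 < f m * deriv f m := hsign m hma (by linarith)
    have hScl : IsClosed (Set.Icc m c ∩ (fun x => f x * deriv f x) ⁻¹' Set.Iic 0) :=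
      (hcg.mono hsub).preimage_isClosed_of_isClosed isClosed_Icc isClosed_Iic
    have hSne : (Set.Icc m c ∩ (fun x => f x * deriv f x) ⁻¹' Set.Iic 0).Nonempty :=
      ⟨c, ⟨hmc.le, le_rfl⟩, hn'⟩
    have hSK : IsCompact (Set.Icc m c ∩ (fun x => f x * deriv f x) ⁻¹' Set.Iic 0) :=
      isCompact_Icc.of_isClosed_subset hScl Set.inter_subset_left
    obtain ⟨x0, ⟨hx0, hgx0⟩, hmin⟩ := hSK.exists_isLeast hSne
    have hgx0 : f x0 * deriv f x0 ≤ 0 := hgx0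
    have hx0' := hsub hx0
    have hleft : ∀ x, m ≤ x → x < x0 → 0 < f x * deriv f x := by
      intro x h1 h2
      by_contra h
      have := hmin ⟨⟨h1, h2.le.trans hx0.2⟩, not_lt.mp h⟩
      linarith
    have hmx0 : m < x0 := lt_of_le_of_ne hx0.1 (by rintro h; rw [← h] at hgx0; linarith)
    have hsq : StrictMonoOn (fun x => f x * f x) (Set.Icc m x0) := by
      have hs : Set.Icc m x0 ⊆ Set.Ioo a b := (Set.Icc_subset_Icc_right hx0.2).trans hsub
      apply strictMonoOn_of_deriv_pos (convex_Icc _ _) ((hcf.mono hs).mul (hcf.mono hs))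
      intro x hx
      rw [interior_Icc] at hx
      have hxx := hd1 x (hs ⟨hx.1.le, hx.2.le⟩)
      have h2 := (hxx.mul hxx).deriv
      have h3 := hleft x hx.1.le hx.2
      change 0 < deriv (f * f) x
      rw [h2]; linarith
    have hf0 : f x0 ≠ 0 := by
      intro h
      have h1 : f m * f m < f x0 * f x0 :=
        hsq ⟨le_rfl, hmx0.le⟩ ⟨hmx0.le, le_rfl⟩ hmx0
      rw [h] at h1
      nlinarith [mul_self_nonneg (f m)]
    have hD : HasDerivAt (fun x => f x * deriv f x)
        (deriv f x0 * deriv f x0 + f x0 * deriv (deriv f) x0) x0 :=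
      (hd1 x0 hx0').mul (hd2 x0 hx0')
    have hIoo : Set.Ioo m x0 ∈ nhdsWithin x0 (Set.Iio x0) := Ioo_mem_nhdsLT hmx0
    have hge : 0 ≤ f x0 * deriv f x0 := by
      have ht : Filter.Tendsto (fun x => f x * deriv f x) (nhdsWithin x0 (Set.Iio x0))
        (nhds (f x0 * deriv f x0)) := hD.continuousAt.continuousWithinAt
      apply ge_of_tendsto ht
      filter_upwards [hIoo] with x hx
      exact (hleft x hx.1.le hx.2).le
    have hz : f x0 * deriv f x0 = 0 := le_antisymm hgx0 hge
    have hdz : deriv f x0 = 0 := (mul_eq_zero.mp hz).resolve_left hf0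
    have hpos : 0 < f x0 * deriv (deriv f) x0 := by
      have h1 := hode x0 hx0'
      have h2 := hpr x0 hx0'
      rw [hdz] at h1
      have hp0 : p x0 ≠ 0 := by rintro h; rw [h] at h2; simp at h2
      have h3 : p x0 ^ 2 * (f x0 * deriv (deriv f) x0) = p x0 * r x0 * f x0 ^ 2 := by
        linear_combination p x0 * f x0 * h1
      have h4 : 0 < p x0 ^ 2 * (f x0 * deriv (deriv f) x0) := by
        rw [h3]; exact mul_pos h2 (by positivity)
      exact (mul_pos_iff_of_pos_left (by positivity)).mp h4
    have hle : deriv f x0 * deriv f x0 + f x0 * deriv (deriv f) x0 ≤ 0 := by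
      have ht := (hasDerivAt_iff_tendsto_slope.mp hD).mono_left
        (nhdsWithin_mono x0 (s := Set.Iio x0) (fun y hy => ne_of_lt hy))
      apply le_of_tendsto ht
      filter_upwards [hIoo] with x hx
      have h1 := hleft x hx.1.le hx.2
      rw [slope_def_field, hz]
      exact div_nonpos_of_nonneg_of_nonpos (by linarith) (by linarith [hx.2])
    rw [hdz] at hle
    linarith
  have hfne : ∀ x ∈ Set.Ioo a b, f x ≠ 0 := fun x hx => left_ne_zero_of_mul (hg x hx).ne'
  have hfne' : ∀ x ∈ Set.Ioo a b, deriv f x ≠ 0 := fun x hx =>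
    right_ne_zero_of_mul (hg x hx).ne'
  refine ⟨?_, fun x hx y hy => sign_aux a b f hcf hfne x hx y ⟨hy.1, hy.2.trans_le hεb⟩⟩
  have hs := sign_aux a b _ hcf' hfne'
  have hmid : (a + b) / 2 ∈ Set.Ioo a b := ⟨by linarith, by linarith⟩
  rcases lt_or_gt_of_ne (hfne' _ hmid) with h | h
  · right
    apply strictAntiOn_of_deriv_neg (convex_Ico _ _) hf.continuousOn
    intro x hx
    rw [interior_Ico] at hx
    exact neg_of_mul_pos_left (hs x hx _ hmid) h.le
  · left
    apply strictMonoOn_of_deriv_pos (convex_Ico _ _) hf.continuousOn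
    intro x hx
    rw [interior_Ico] at hx
    exact pos_of_mul_pos_left (hs x hx _ hmid) h.le
end

section
/- Let m ≥ 1 be an integer and let α, β, ρ be real numbers with 𝓔𝓕 ≠ 0 (that is, |α| ≠ |β|, or |α| = |β| but |sin ρ| < 1). If the bifurcation system (B) for the (m:1) resonance has a solution (e, ℓ, g), then at that value of e the quantity (A_m(e)² − B_m(e)²)·[(A_m'(e) + B_m'(e))²𝓕² − (A_m'(e) − B_m'(e))²𝓔²] is zero. -/
open Real Set

/-- Bessel function of integer order `n`. -/
noncomputable def besselJ (n : ℤ) (x : ℝ) : ℝ :=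
  (1 / (2 * π)) * ∫ t in (0:ℝ)..(2 * π), Real.cos (n * t - x * Real.sin t)

/-- Derivative of the Bessel function with respect to its argument. -/
noncomputable def besselJd (n : ℤ) (x : ℝ) : ℝ := deriv (besselJ n) x

/-- The Fourier coefficient `A_m(e)`. -/
noncomputable def coefA (m : ℕ) (e : ℝ) : ℝ :=
  (4 / ((m:ℝ) ^ 2 * e ^ 2)) *
    (2 * m * e * (1 - e ^ 2) * besselJd m (m * e) - (2 - e ^ 2) * besselJ m (m * e))

/-- The Fourier coefficient `B_m(e)`. -/
noncomputable def coefB (m : ℕ) (e : ℝ) : ℝ :=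
  -(8 / ((m:ℝ) ^ 2 * e ^ 2)) * Real.sqrt (1 - e ^ 2) *
    (e * besselJd m (m * e) - m * (1 - e ^ 2) * besselJ m (m * e))

/-- `𝓔 = √(α²+β²+2αβ sin ρ)`. -/
noncomputable def calE (α β ρ : ℝ) : ℝ := Real.sqrt (α ^ 2 + β ^ 2 + 2 * α * β * Real.sin ρ)

/-- `𝓕 = √(α²+β²−2αβ sin ρ)`. -/
noncomputable def calF (α β ρ : ℝ) : ℝ := Real.sqrt (α ^ 2 + β ^ 2 - 2 * α * β * Real.sin ρ)

/-- First equation of the bifurcation system (B): `𝓕(A_m+B_m)cos(2g+mℓ+τ)`. -/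
noncomputable def bifF1 (m : ℕ) (α β ρ τ : ℝ) (e ℓ g : ℝ) : ℝ :=
  calF α β ρ * (coefA m e + coefB m e) * Real.cos (2 * g + m * ℓ + τ)

/-- Second equation of the bifurcation system (B): `𝓔(A_m−B_m)cos(2g−mℓ+σ)`. -/
noncomputable def bifF2 (m : ℕ) (α β ρ σ : ℝ) (e ℓ g : ℝ) : ℝ :=
  calE α β ρ * (coefA m e - coefB m e) * Real.cos (2 * g - m * ℓ + σ)

/-- Third equation of the bifurcation system (B):
`(A_m'+B_m')𝓕 sin(2g+mℓ+τ) + (A_m'−B_m')𝓔 sin(2g−mℓ+σ)`. -/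
noncomputable def bifF3 (m : ℕ) (α β ρ σ τ : ℝ) (e ℓ g : ℝ) : ℝ :=
  (deriv (coefA m) e + deriv (coefB m) e) * calF α β ρ * Real.sin (2 * g + m * ℓ + τ) +
  (deriv (coefA m) e - deriv (coefB m) e) * calE α β ρ * Real.sin (2 * g - m * ℓ + σ)

/-- The solution set of the bifurcation system (B) for the `(m:1)` resonance, in the
unknowns `(e, ℓ, g) ∈ (0,1) × [0,2π) × [0,2π)`. -/
noncomputable def bifSolSet (m : ℕ) (α β ρ σ τ : ℝ) : Set (ℝ × ℝ × ℝ) :=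
  {p | p.1 ∈ Set.Ioo (0:ℝ) 1 ∧ p.2.1 ∈ Set.Ico (0:ℝ) (2 * π) ∧
       p.2.2 ∈ Set.Ico (0:ℝ) (2 * π) ∧
       bifF1 m α β ρ τ p.1 p.2.1 p.2.2 = 0 ∧
       bifF2 m α β ρ σ p.1 p.2.1 p.2.2 = 0 ∧
       bifF3 m α β ρ σ τ p.1 p.2.1 p.2.2 = 0}

/-- Jacobian determinant of the three left-hand sides of system (B) with respect to
`(e, ℓ, g)`; a solution is simple when this is nonzero. -/
noncomputable def bifJac (m : ℕ) (α β ρ σ τ : ℝ) (e ℓ g : ℝ) : ℝ :=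
  Matrix.det
    !![deriv (fun x => bifF1 m α β ρ τ x ℓ g) e,
       deriv (fun x => bifF1 m α β ρ τ e x g) ℓ,
       deriv (fun x => bifF1 m α β ρ τ e ℓ x) g;
       deriv (fun x => bifF2 m α β ρ σ x ℓ g) e,
       deriv (fun x => bifF2 m α β ρ σ e x g) ℓ,
       deriv (fun x => bifF2 m α β ρ σ e ℓ x) g;
       deriv (fun x => bifF3 m α β ρ σ τ x ℓ g) e,
       deriv (fun x => bifF3 m α β ρ σ τ e x g) ℓ,
       deriv (fun x => bifF3 m α β ρ σ τ e ℓ x) g]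

/-- If `𝓔𝓕 ≠ 0` and the bifurcation system (B) for the `(m:1)` resonance has a solution
`(e, ℓ, g)`, then `(A_m² − B_m²)·[(A_m'+B_m')²𝓕² − (A_m'−B_m')²𝓔²]` vanishes at `e`. -/
theorem stmt_2 (m : ℕ) (hm : 1 ≤ m) (α β ρ : ℝ)
    (hEF : calE α β ρ * calF α β ρ ≠ 0)
    (σ τ : ℝ)
    (hσ1 : calE α β ρ * Real.cos σ = β * Real.cos ρ)
    (hσ2 : calE α β ρ * Real.sin σ = α + β * Real.sin ρ)
    (hτ1 : calF α β ρ * Real.cos τ = β * Real.cos ρ)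
    (hτ2 : calF α β ρ * Real.sin τ = α - β * Real.sin ρ)
    (e ℓ g : ℝ) (hsol : (e, ℓ, g) ∈ bifSolSet m α β ρ σ τ) :
    (coefA m e ^ 2 - coefB m e ^ 2) *
      ((deriv (coefA m) e + deriv (coefB m) e) ^ 2 * calF α β ρ ^ 2 -
       (deriv (coefA m) e - deriv (coefB m) e) ^ 2 * calE α β ρ ^ 2) = 0 := by 
  obtain ⟨-, -, -, h1, h2, h3⟩ := hsol
  simp only [bifF1, bifF2, bifF3] at h1 h2 h3
  have hE : calE α β ρ ≠ 0 := left_ne_zero_of_mul hEF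
  have hF : calF α β ρ ≠ 0 := right_ne_zero_of_mul hEF
  have s1 := Real.sin_sq_add_cos_sq (2 * g + m * ℓ + τ)
  have s2 := Real.sin_sq_add_cos_sq (2 * g - m * ℓ + σ)
  generalize Real.cos (2 * g + m * ℓ + τ) = c1 at *
  generalize Real.sin (2 * g + m * ℓ + τ) = d1 at *
  generalize Real.cos (2 * g - m * ℓ + σ) = c2 at *
  generalize Real.sin (2 * g - m * ℓ + σ) = d2 at *
  generalize deriv (coefA m) e + deriv (coefB m) e = P at *
  generalize deriv (coefA m) e - deriv (coefB m) e = Q at *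
  rcases mul_eq_zero.mp h1 with h | h
  · have h' := (mul_eq_zero.mp h).resolve_left hF
    linear_combination (coefA m e - coefB m e) *
      (P ^ 2 * calF α β ρ ^ 2 - Q ^ 2 * calE α β ρ ^ 2) * h'
  rcases mul_eq_zero.mp h2 with k | k
  · have h' := (mul_eq_zero.mp k).resolve_left hE
    linear_combination (coefA m e + coefB m e) *
      (P ^ 2 * calF α β ρ ^ 2 - Q ^ 2 * calE α β ρ ^ 2) * h'
  subst h k
  have key : P ^ 2 * calF α β ρ ^ 2 - Q ^ 2 * calE α β ρ ^ 2 = 0 := by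
    linear_combination (P * calF α β ρ * d1 - Q * calE α β ρ * d2) * h3
      - P ^ 2 * calF α β ρ ^ 2 * s1 + Q ^ 2 * calE α β ρ ^ 2 * s2
  rw [key, mul_zero]
end

section
/- For every e ∈ (0,1) one has A₁(e) − B₁(e) < 0; equivalently, the function f(e) := 2e((1−e²) + √(1−e²))J₁'(e) − ((2−e²) + 2(1−e²)^{3/2})J₁(e), which equals (e²/4)(A₁(e) − B₁(e)), is negative on the interval 0 < e < 1. -/
open Real Set

lemma aux_cos (y : ℝ) (hy : |y| ≤ 1) : Real.cos y ≤ 1 - y ^ 2 / 2 + y ^ 4 / 24 := by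
  have key : ∀ z : ℝ, 0 ≤ z → z ≤ 1 → Real.cos z ≤ 1 - z ^ 2 / 2 + z ^ 4 / 24 := by
    intro z h0 h1
    have h := Real.sin_ge_sub_cube (x := z / 2) (by linarith)
    have hp : 0 ≤ z / 2 - (z / 2) ^ 3 / 6 := by
      nlinarith [mul_nonneg h0 (by nlinarith : (0:ℝ) ≤ 1 - z ^ 2)]
    have h2 : (z / 2 - (z / 2) ^ 3 / 6) ^ 2 ≤ Real.sin (z / 2) ^ 2 := by gcongr
    have h3 : Real.cos z = 1 - 2 * Real.sin (z / 2) ^ 2 := by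
      have := Real.cos_two_mul (z / 2)
      rw [show 2 * (z / 2) = z by ring] at this
      have h4 := Real.sin_sq_add_cos_sq (z / 2)
      linarith
    rw [h3]
    nlinarith [pow_nonneg h0 6]
  have := key |y| (abs_nonneg y) hy
  rw [Real.cos_abs, sq_abs, show |y| ^ 4 = y ^ 4 from (by decide : Even 4).pow_abs y] at this
  exact this

lemma aux_sin (y : ℝ) : y ^ 2 - y ^ 4 / 6 ≤ y * Real.sin y := by
  have key : ∀ z : ℝ, 0 ≤ z → z ^ 2 - z ^ 4 / 6 ≤ z * Real.sin z := by
    intro z h0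
    have := mul_le_mul_of_nonneg_left (Real.sin_ge_sub_cube h0) h0
    nlinarith
  rcases le_total 0 y with h | h
  · exact key y h
  · have := key (-y) (by linarith)
    rw [Real.sin_neg] at this
    nlinarith

lemma aux_vanish (g : ℝ → ℝ) (hg : Continuous g) :
    ∫ t in (0:ℝ)..(2 * π), g (Real.sin t) * Real.cos t = 0 := by
  have := intervalIntegral.integral_comp_mul_deriv (a := 0) (b := 2 * π) (f := Real.sin)
    (f' := Real.cos) (g := g) (fun x _ => Real.hasDerivAt_sin x)
    Real.continuous_cos.continuousOn hg
  simpa using this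

lemma aux_s2 : ∫ t in (0:ℝ)..(2 * π), Real.sin t ^ 2 = π := by
  have := integral_sin_pow (a := 0) (b := 2 * π) 0
  simp at this
  rw [integral_sin_sq]; simp
lemma aux_s4 : ∫ t in (0:ℝ)..(2 * π), Real.sin t ^ 4 = 3 / 4 * π := by
  have := integral_sin_pow (a := 0) (b := 2 * π) 2
  rw [aux_s2] at this
  norm_num at this
  exact this
lemma aux_s6 : ∫ t in (0:ℝ)..(2 * π), Real.sin t ^ 6 = 5 / 8 * π := by
  have := integral_sin_pow (a := 0) (b := 2 * π) 4
  rw [aux_s4] at this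
  norm_num at this
  rw [this]; ring

lemma aux_J (x : ℝ) (hx : 0 < x) : x / 2 - x ^ 3 / 16 ≤ besselJ 1 x := by
  have h1 : ∫ t in (0:ℝ)..(2 * π), Real.cos (((1:ℤ):ℝ) * t - x * Real.sin t) =
      ∫ t in (0:ℝ)..(2 * π), Real.sin t * Real.sin (x * Real.sin t) := by
    have e1 : ∀ t : ℝ, Real.cos (((1:ℤ):ℝ) * t - x * Real.sin t) =
        Real.cos (x * Real.sin t) * Real.cos t + Real.sin t * Real.sin (x * Real.sin t) := by
      intro t; push_cast; rw [one_mul, Real.cos_sub]; ring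
    simp_rw [e1]
    rw [intervalIntegral.integral_add
      (Continuous.intervalIntegrable (by fun_prop) _ _)
      (Continuous.intervalIntegrable (by fun_prop) _ _),
      aux_vanish (fun y => Real.cos (x * y)) (by fun_prop), zero_add]
  have h2 : ∫ t in (0:ℝ)..(2 * π), (x * Real.sin t ^ 2 - x ^ 3 / 6 * Real.sin t ^ 4) ≤
      ∫ t in (0:ℝ)..(2 * π), Real.sin t * Real.sin (x * Real.sin t) := by
    apply intervalIntegral.integral_mono_on (by positivity)
      (Continuous.intervalIntegrable (by fun_prop) _ _)
      (Continuous.intervalIntegrable (by fun_prop) _ _)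
    intro t _
    have h := aux_sin (x * Real.sin t)
    refine le_of_mul_le_mul_left ?_ hx
    nlinarith
  rw [intervalIntegral.integral_sub
      (Continuous.intervalIntegrable (by fun_prop) _ _)
      (Continuous.intervalIntegrable (by fun_prop) _ _),
    intervalIntegral.integral_const_mul, intervalIntegral.integral_const_mul,
    aux_s2, aux_s4] at h2
  unfold besselJ
  rw [h1]
  have hpi := Real.pi_pos
  calc x / 2 - x ^ 3 / 16 = 1 / (2 * π) * (x * π - x ^ 3 / 6 * (3 / 4 * π)) := by
        field_simp; ring
    _ ≤ _ := by gcongr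

lemma aux_Jd_eq (x : ℝ) : besselJd 1 x = 1 / (2 * π) *
    ∫ t in (0:ℝ)..(2 * π), Real.sin (((1:ℤ):ℝ) * t - x * Real.sin t) * Real.sin t := by
  have := (intervalIntegral.hasDerivAt_integral_of_dominated_loc_of_deriv_le
    (μ := MeasureTheory.volume) (a := 0) (b := 2 * π)
    (F := fun x t => Real.cos (((1:ℤ):ℝ) * t - x * Real.sin t))
    (F' := fun x t => Real.sin (((1:ℤ):ℝ) * t - x * Real.sin t) * Real.sin t)
    (x₀ := x) (s := Set.univ) (bound := fun _ => 1) Filter.univ_mem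
    (Filter.Eventually.of_forall fun y => (by fun_prop : Continuous _).aestronglyMeasurable)
    (Continuous.intervalIntegrable (by fun_prop) _ _)
    (by fun_prop : Continuous _).aestronglyMeasurable
    (Filter.Eventually.of_forall fun t _ y _ => by
      rw [norm_mul]
      exact mul_le_one₀ (Real.abs_sin_le_one _) (norm_nonneg _) (Real.abs_sin_le_one _))
    (Continuous.intervalIntegrable (by fun_prop) _ _)
    (Filter.Eventually.of_forall fun t _ y _ => by
      have h : HasDerivAt (fun y : ℝ => ((1:ℤ):ℝ) * t - y * Real.sin t) (-(1 * Real.sin t)) y :=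
        ((hasDerivAt_id y).mul_const (Real.sin t)).const_sub _
      have h5 := h.cos
      rw [show -Real.sin (((1:ℤ):ℝ) * t - y * Real.sin t) * -(1 * Real.sin t) = Real.sin (((1:ℤ):ℝ) * t - y * Real.sin t) * Real.sin t by ring] at h5
      exact h5)).2
  exact (this.const_mul (1 / (2 * π))).deriv

lemma aux_Jd (x : ℝ) (hx : 0 < x) (hx1 : x < 1) :
    besselJd 1 x ≤ 1 / 2 - 3 * x ^ 2 / 16 + 5 * x ^ 4 / 384 := by
  have h1 : ∫ t in (0:ℝ)..(2 * π), Real.sin (((1:ℤ):ℝ) * t - x * Real.sin t) * Real.sin t =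
      ∫ t in (0:ℝ)..(2 * π), Real.sin t ^ 2 * Real.cos (x * Real.sin t) := by
    have e1 : ∀ t : ℝ, Real.sin (((1:ℤ):ℝ) * t - x * Real.sin t) * Real.sin t =
        Real.sin t ^ 2 * Real.cos (x * Real.sin t) -
          (Real.sin t * Real.sin (x * Real.sin t)) * Real.cos t := by
      intro t; push_cast; rw [one_mul, Real.sin_sub]; ring
    simp_rw [e1]
    rw [intervalIntegral.integral_sub
      (Continuous.intervalIntegrable (by fun_prop) _ _)
      (Continuous.intervalIntegrable (by fun_prop) _ _),
      aux_vanish (fun y => y * Real.sin (x * y)) (by fun_prop), sub_zero]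
  have h2 : ∫ t in (0:ℝ)..(2 * π), Real.sin t ^ 2 * Real.cos (x * Real.sin t) ≤
      ∫ t in (0:ℝ)..(2 * π), (Real.sin t ^ 2 - x ^ 2 / 2 * Real.sin t ^ 4 +
        x ^ 4 / 24 * Real.sin t ^ 6) := by
    apply intervalIntegral.integral_mono_on (by positivity)
      (Continuous.intervalIntegrable (by fun_prop) _ _)
      (Continuous.intervalIntegrable (by fun_prop) _ _)
    intro t _
    have hb : |x * Real.sin t| ≤ 1 := by
      rw [abs_mul, abs_of_pos hx]
      exact mul_le_one₀ hx1.le (abs_nonneg _) (Real.abs_sin_le_one _)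
    have h := mul_le_mul_of_nonneg_left (aux_cos _ hb) (sq_nonneg (Real.sin t))
    linarith
  rw [intervalIntegral.integral_add
      (Continuous.intervalIntegrable (by fun_prop) _ _)
      (Continuous.intervalIntegrable (by fun_prop) _ _),
    intervalIntegral.integral_sub
      (Continuous.intervalIntegrable (by fun_prop) _ _)
      (Continuous.intervalIntegrable (by fun_prop) _ _),
    intervalIntegral.integral_const_mul, intervalIntegral.integral_const_mul,
    aux_s2, aux_s4, aux_s6] at h2
  rw [aux_Jd_eq, h1]
  have hpi := Real.pi_pos
  calc _ ≤ 1 / (2 * π) * (π - x ^ 2 / 2 * (3 / 4 * π) + x ^ 4 / 24 * (5 / 8 * π)) := by gcongr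
    _ = _ := by field_simp; ring

/-- For every `e ∈ (0,1)`, `A₁(e) − B₁(e) < 0`; equivalently the function
`f(e) = 2e((1−e²)+√(1−e²))J₁'(e) − ((2−e²)+2(1−e²)^{3/2})J₁(e) = (e²/4)(A₁(e)−B₁(e))`
is negative on `0 < e < 1`. -/
theorem stmt_3 (e : ℝ) (he : e ∈ Set.Ioo (0:ℝ) 1) :
    coefA 1 e - coefB 1 e < 0 ∧
    2 * e * ((1 - e ^ 2) + Real.sqrt (1 - e ^ 2)) * besselJd 1 e -
      ((2 - e ^ 2) + 2 * Real.sqrt (1 - e ^ 2) ^ 3) * besselJ 1 e < 0 ∧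
    2 * e * ((1 - e ^ 2) + Real.sqrt (1 - e ^ 2)) * besselJd 1 e -
      ((2 - e ^ 2) + 2 * Real.sqrt (1 - e ^ 2) ^ 3) * besselJ 1 e =
      (e ^ 2 / 4) * (coefA 1 e - coefB 1 e) := by
  obtain ⟨h0, h1⟩ := he
  have hpos : 0 < 1 - e ^ 2 := by nlinarith
  set s := Real.sqrt (1 - e ^ 2) with hs
  have hs0 : 0 < s := Real.sqrt_pos.mpr hpos
  have hss : s ^ 2 = 1 - e ^ 2 := Real.sq_sqrt hpos.le
  have hs1 : s < 1 := by nlinarith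
  have heq : 2 * e * ((1 - e ^ 2) + s) * besselJd 1 e -
      ((2 - e ^ 2) + 2 * s ^ 3) * besselJ 1 e =
      (e ^ 2 / 4) * (coefA 1 e - coefB 1 e) := by
    unfold coefA coefB
    rw [← hs]
    simp only [Nat.cast_one, one_mul, mul_one, one_pow]
    rw [show s ^ 3 = s * (1 - e ^ 2) by rw [← hss]; ring]
    field_simp
    ring
  have hneg : 2 * e * ((1 - e ^ 2) + s) * besselJd 1 e -
      ((2 - e ^ 2) + 2 * s ^ 3) * besselJ 1 e < 0 := by
    have hJ := aux_J e h0
    have hD := aux_Jd e h0 h1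
    have a1 := mul_le_mul_of_nonneg_left hD (by positivity : 0 ≤ 2 * e * ((1 - e ^ 2) + s))
    have a2 := mul_le_mul_of_nonneg_left hJ
      (by nlinarith [pow_pos hs0 3] : 0 ≤ (2 - e ^ 2) + 2 * s ^ 3)
    have he2 : e ^ 2 = 1 - s ^ 2 := by linarith
    have a3 : 2 * e * ((1 - e ^ 2) + s) * (1 / 2 - 3 * e ^ 2 / 16 + 5 * e ^ 4 / 384) -
        ((2 - e ^ 2) + 2 * s ^ 3) * (e / 2 - e ^ 3 / 16) =
        -(e / 192 * (1 - s) ^ 2 * (84 + 43 * s - 27 * s ^ 2 + 9 * s ^ 3 - 5 * s ^ 4)) := by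
      rw [show e ^ 4 = (e ^ 2) ^ 2 by ring, show e ^ 3 = e * e ^ 2 by ring, he2]
      ring
    have hq : 0 < 84 + 43 * s - 27 * s ^ 2 + 9 * s ^ 3 - 5 * s ^ 4 := by
      have b2 : s ^ 2 ≤ 1 := pow_le_one₀ hs0.le hs1.le
      have b4 : s ^ 4 ≤ 1 := pow_le_one₀ hs0.le hs1.le
      have b3 := pow_pos hs0 3
      linarith
    have hs1' : 0 < 1 - s := by linarith
    have : 0 < e / 192 * (1 - s) ^ 2 * (84 + 43 * s - 27 * s ^ 2 + 9 * s ^ 3 - 5 * s ^ 4) := by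
      positivity
    linarith
  refine ⟨?_, hneg, heq⟩
  rw [heq] at hneg
  by_contra hc
  push Not at hc
  have : 0 ≤ e ^ 2 / 4 * (coefA 1 e - coefB 1 e) := by positivity
  linarith
end

section
/- For every e ∈ (0,1) one has A₁(e) + B₁(e) < 0, where A₁ and B₁ are the first Fourier coefficients associated with the (1:1) resonance. -/
open Real Set

lemma bJ_eq (x : ℝ) (hx : x ∈ Set.Ioo (0:ℝ) 1) :
    besselJ 1 x = (1 / (2 * π)) * ∫ t in (0:ℝ)..(2 * π), Real.sin t * Real.sin (x * Real.sin t) := by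
  unfold besselJ
  congr 1
  have h0 : ∫ t in (0:ℝ)..(2 * π), Real.cos t * Real.cos (x * Real.sin t) = 0 := by
    have h : ∀ t ∈ Set.uIcc (0:ℝ) (2 * π), HasDerivAt (fun t => Real.sin (x * Real.sin t) / x)
        (Real.cos t * Real.cos (x * Real.sin t)) t := by
      intro t _
      have hne : x ≠ 0 := ne_of_gt hx.1
      refine HasDerivAt.congr_deriv (((Real.hasDerivAt_sin t).const_mul x).sin.div_const x) ?_
      rw [div_eq_iff hne]
      ring
    rw [intervalIntegral.integral_eq_sub_of_hasDerivAt h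
      (Continuous.intervalIntegrable (by fun_prop) _ _)]
    simp
  have h1 : ∀ t : ℝ, Real.cos (((1:ℤ):ℝ) * t - x * Real.sin t) =
      Real.cos t * Real.cos (x * Real.sin t) + Real.sin t * Real.sin (x * Real.sin t) := by
    intro t
    rw [← Real.cos_sub]; simp
  simp_rw [h1]
  rw [intervalIntegral.integral_add (Continuous.intervalIntegrable (by fun_prop) _ _)
    (Continuous.intervalIntegrable (by fun_prop) _ _), h0, zero_add]

lemma sin_aux (x y s : ℝ) (hx : 0 ≤ x) (hxy : x ≤ y) (hy : y ≤ 1) (h1 : -1 ≤ s) (h2 : s ≤ 1) :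
    s * Real.sin (x * s) ≤ s * Real.sin (y * s) := by
  have hp := Real.pi_gt_three
  rcases le_total 0 s with h | h
  · apply mul_le_mul_of_nonneg_left _ h
    apply Real.sin_le_sin_of_le_of_le_pi_div_two <;> nlinarith
  · apply mul_le_mul_of_nonpos_left _ h
    apply Real.sin_le_sin_of_le_of_le_pi_div_two <;> nlinarith

lemma bJ_mono : MonotoneOn (besselJ 1) (Set.Ioo (0:ℝ) 1) := by
  intro x hx y hy hxy
  rw [bJ_eq x hx, bJ_eq y hy]
  apply mul_le_mul_of_nonneg_left _ (by positivity)
  apply intervalIntegral.integral_mono_on (by positivity)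
    (Continuous.intervalIntegrable (by fun_prop) _ _)
    (Continuous.intervalIntegrable (by fun_prop) _ _)
  intro t _
  exact sin_aux x y _ hx.1.le hxy hy.2.le (Real.neg_one_le_sin t) (Real.sin_le_one t)

lemma bJ_pos (x : ℝ) (hx : x ∈ Set.Ioo (0:ℝ) 1) : 0 < besselJ 1 x := by
  rw [bJ_eq x hx]
  apply mul_pos (by positivity)
  have hp := Real.pi_gt_three
  apply intervalIntegral.integral_pos (by positivity) (by fun_prop)
  · intro t _
    have := sin_aux 0 x _ le_rfl hx.1.le hx.2.le (Real.neg_one_le_sin t) (Real.sin_le_one t)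
    simpa using this
  · refine ⟨π / 2, ⟨by positivity, by linarith⟩, ?_⟩
    simp only [Real.sin_pi_div_two, one_mul, mul_one]
    exact Real.sin_pos_of_pos_of_lt_pi hx.1 (by linarith [hx.2])

lemma bJd_nonneg (x : ℝ) (hx : x ∈ Set.Ioo (0:ℝ) 1) : 0 ≤ besselJd 1 x := by
  unfold besselJd
  rw [← derivWithin_of_isOpen isOpen_Ioo hx]
  exact bJ_mono.derivWithin_nonneg

/-- For every `e ∈ (0,1)` one has `A₁(e) + B₁(e) < 0`. -/
theorem stmt_4 (e : ℝ) (he : e ∈ Set.Ioo (0:ℝ) 1) :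
    coefA 1 e + coefB 1 e < 0 := by
  have hJ := bJ_pos e he
  have hD := bJd_nonneg e he
  obtain ⟨h0, h1⟩ := he
  have hs : 0 < Real.sqrt (1 - e ^ 2) := Real.sqrt_pos.mpr (by nlinarith)
  have hsq : Real.sqrt (1 - e ^ 2) ^ 2 = 1 - e ^ 2 := Real.sq_sqrt (by nlinarith)
  unfold coefA coefB
  simp only [Nat.cast_one, one_mul, one_pow, mul_one]
  set s := Real.sqrt (1 - e ^ 2)
  set J := besselJ 1 e
  set D := besselJd 1 e
  have hs1 : s < 1 := by nlinarith
  have he2 : 2 - e ^ 2 = 1 + s ^ 2 := by linarith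
  have key : 4 / e ^ 2 * (2 * e * (1 - e ^ 2) * D - (2 - e ^ 2) * J) +
      -(8 / e ^ 2) * s * (e * D - (1 - e ^ 2) * J) =
      -(4 / e ^ 2 * ((1 - s) * (2 * e * s * D + (2 * s ^ 2 + s + 1) * J))) := by
    rw [he2, ← hsq]
    ring
  have hpos : 0 < 4 / e ^ 2 * ((1 - s) * (2 * e * s * D + (2 * s ^ 2 + s + 1) * J)) := by
    have : 0 < 1 - s := by linarith
    positivity
  rw [key]
  linarith
end

section
/- The function β̂(e) := −3(1−e²)J₁(e) + e((2−e²)(1−e²) + 1)J₁'(e) has exactly one zero on the interval 0 < e < 1, and this zero is simple (the derivative of β̂ is nonzero there). Equivalently, the partial derivative ∂B₁/∂G = −(8/(Le⁴))·β̂(e) of the Fourier coefficient B₁ with respect to the Delaunay action G (with L > 0 fixed) has exactly one simple zero for 0 < e < 1. -/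
open Real Set

/-- The function `β̂(e) = −3(1−e²)J₁(e) + e((2−e²)(1−e²)+1)J₁'(e)`, a negative nonvanishing
multiple of `∂B₁/∂G`. -/
noncomputable def betaHat (e : ℝ) : ℝ :=
  -3 * (1 - e ^ 2) * besselJ 1 e + e * ((2 - e ^ 2) * (1 - e ^ 2) + 1) * besselJd 1 e


namespace BH

lemma cos_le4_nn {u : ℝ} (hu : 0 ≤ u) : cos u ≤ 1 - u ^ 2 / 2 + u ^ 4 / 24 := by
  have hd : ∀ x, HasDerivAt (fun x : ℝ => 1 - x ^ 2 / 2 + x ^ 4 / 24 - cos x)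
      (-x + x ^ 3 / 6 + sin x) x := by
    intro x
    have := ((((hasDerivAt_const x (1:ℝ)).sub ((hasDerivAt_pow 2 x).div_const 2)).add
      ((hasDerivAt_pow 4 x).div_const 24)).sub (Real.hasDerivAt_cos x))
    refine this.congr_deriv ?_
    push_cast; ring
  have hm : MonotoneOn (fun x : ℝ => 1 - x ^ 2 / 2 + x ^ 4 / 24 - cos x) (Ici 0) := by
    apply monotoneOn_of_deriv_nonneg (convex_Ici 0)
    · exact fun x _ => (hd x).continuousAt.continuousWithinAt
    · exact fun x _ => (hd x).differentiableAt.differentiableWithinAt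
    · intro x hx
      rw [interior_Ici] at hx
      rw [(hd x).deriv]
      have := sin_ge_sub_cube (le_of_lt hx)
      linarith
  have := hm (self_mem_Ici) hu hu
  simp at this
  linarith

lemma cos_le4 (u : ℝ) : cos u ≤ 1 - u ^ 2 / 2 + u ^ 4 / 24 := by
  rcases le_total 0 u with h | h
  · exact cos_le4_nn h
  · have := cos_le4_nn (neg_nonneg.2 h)
    rw [cos_neg] at this
    nlinarith

lemma sin_le5 {u : ℝ} (hu : 0 ≤ u) : sin u ≤ u - u ^ 3 / 6 + u ^ 5 / 120 := by
  have hd : ∀ x, HasDerivAt (fun x : ℝ => x - x ^ 3 / 6 + x ^ 5 / 120 - sin x)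
      (1 - x ^ 2 / 2 + x ^ 4 / 24 - cos x) x := by
    intro x
    have := ((((hasDerivAt_id x).sub ((hasDerivAt_pow 3 x).div_const 6)).add
      ((hasDerivAt_pow 5 x).div_const 120)).sub (Real.hasDerivAt_sin x))
    refine this.congr_deriv ?_
    push_cast; ring
  have hm : MonotoneOn (fun x : ℝ => x - x ^ 3 / 6 + x ^ 5 / 120 - sin x) (Ici 0) := by
    apply monotoneOn_of_deriv_nonneg (convex_Ici 0)
    · exact fun x _ => (hd x).continuousAt.continuousWithinAt
    · exact fun x _ => (hd x).differentiableAt.differentiableWithinAt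
    · intro x hx
      rw [(hd x).deriv]
      have := cos_le4 x
      linarith
  have := hm (self_mem_Ici) hu hu
  simp at this
  linarith

lemma ssin_ge {x : ℝ} (hx : 0 ≤ x) (s : ℝ) :
    x * s ^ 2 - x ^ 3 / 6 * s ^ 4 ≤ s * sin (x * s) := by
  rcases le_total 0 s with h | h
  · have := mul_le_mul_of_nonneg_left (sin_ge_sub_cube (mul_nonneg hx h)) h
    nlinarith
  · have h' := neg_nonneg.2 h
    have := mul_le_mul_of_nonneg_left (sin_ge_sub_cube (mul_nonneg hx h')) h'
    rw [mul_neg x s, sin_neg] at this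
    nlinarith

lemma s3sin_le {x : ℝ} (hx : 0 ≤ x) (s : ℝ) :
    s ^ 3 * sin (x * s) ≤ x * s ^ 4 - x ^ 3 / 6 * s ^ 6 + x ^ 5 / 120 * s ^ 8 := by
  rcases le_total 0 s with h | h
  · have := mul_le_mul_of_nonneg_left (sin_le5 (mul_nonneg hx h)) (pow_nonneg h 3)
    nlinarith
  · have h' := neg_nonneg.2 h
    have := mul_le_mul_of_nonneg_left (sin_le5 (mul_nonneg hx h')) (pow_nonneg h' 3)
    rw [mul_neg x s, sin_neg] at this
    nlinarith

noncomputable def IS (k : ℕ) (x : ℝ) : ℝ :=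
  (1 / (2 * π)) * ∫ t in (0:ℝ)..(2 * π), sin t ^ k * sin (x * sin t)

noncomputable def IC (k : ℕ) (x : ℝ) : ℝ :=
  (1 / (2 * π)) * ∫ t in (0:ℝ)..(2 * π), sin t ^ k * cos (x * sin t)

lemma bound_aux (k : ℕ) (t c : ℝ) (hc : |c| ≤ 1) : ‖sin t ^ k * c‖ ≤ 1 := by
  rw [norm_mul, norm_pow]
  exact mul_le_one₀ (pow_le_one₀ (norm_nonneg _) (abs_sin_le_one t)) (norm_nonneg _) hc

lemma hasDerivAt_IS (k : ℕ) (x : ℝ) : HasDerivAt (IS k) (IC (k + 1) x) x := by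
  unfold IS IC
  apply HasDerivAt.const_mul
  refine (intervalIntegral.hasDerivAt_integral_of_dominated_loc_of_deriv_le
    (F := fun x t => sin t ^ k * sin (x * sin t))
    (F' := fun x t => sin t ^ (k + 1) * cos (x * sin t))
    (bound := fun _ => 1) (s := univ) Filter.univ_mem ?_ ?_ ?_ ?_ ?_ ?_).2
  · exact Filter.Eventually.of_forall fun y =>
      (by fun_prop : Continuous fun t => sin t ^ k * sin (y * sin t)).aestronglyMeasurable
  · exact (by fun_prop : Continuous fun t => sin t ^ k * sin (x * sin t)).intervalIntegrable _ _
  · exact (by fun_prop :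
      Continuous fun t => sin t ^ (k + 1) * cos (x * sin t)).aestronglyMeasurable
  · exact Filter.Eventually.of_forall fun t _ y _ => bound_aux _ _ _ (abs_cos_le_one _)
  · exact continuous_const.intervalIntegrable _ _
  · refine Filter.Eventually.of_forall fun t _ y _ => ?_
    have := (((hasDerivAt_id y).mul_const (sin t)).sin).const_mul (sin t ^ k)
    refine this.congr_deriv ?_
    simp; ring

lemma hasDerivAt_IC (k : ℕ) (x : ℝ) : HasDerivAt (IC k) (-IS (k + 1) x) x := by
  unfold IS IC
  rw [← mul_neg, ← intervalIntegral.integral_neg]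
  apply HasDerivAt.const_mul
  refine (intervalIntegral.hasDerivAt_integral_of_dominated_loc_of_deriv_le
    (F := fun x t => sin t ^ k * cos (x * sin t))
    (F' := fun x t => -(sin t ^ (k + 1) * sin (x * sin t)))
    (bound := fun _ => 1) (s := univ) Filter.univ_mem ?_ ?_ ?_ ?_ ?_ ?_).2
  · exact Filter.Eventually.of_forall fun y =>
      (by fun_prop : Continuous fun t => sin t ^ k * cos (y * sin t)).aestronglyMeasurable
  · exact (by fun_prop : Continuous fun t => sin t ^ k * cos (x * sin t)).intervalIntegrable _ _
  · exact (by fun_prop :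
      Continuous fun t => -(sin t ^ (k + 1) * sin (x * sin t))).aestronglyMeasurable
  · refine Filter.Eventually.of_forall fun t _ y _ => ?_
    rw [norm_neg]
    exact bound_aux _ _ _ (abs_sin_le_one _)
  · exact continuous_const.intervalIntegrable _ _
  · refine Filter.Eventually.of_forall fun t _ y _ => ?_
    have := (((hasDerivAt_id y).mul_const (sin t)).cos).const_mul (sin t ^ k)
    refine this.congr_deriv ?_
    simp; ring

lemma besselJ_one (x : ℝ) : besselJ 1 x = IS 1 x := by
  unfold besselJ IS
  congr 1
  have h1 : (∫ t in (0:ℝ)..(2 * π), cos (x * sin t) * cos t) = 0 := by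
    have := intervalIntegral.integral_comp_mul_deriv (a := 0) (b := 2 * π) (f := sin) (f' := cos)
      (g := fun u => cos (x * u)) (fun t _ => Real.hasDerivAt_sin t)
      continuous_cos.continuousOn (by fun_prop)
    simpa using this
  have h2 : ∀ t : ℝ, cos (((1:ℤ):ℝ) * t - x * sin t)
      = cos (x * sin t) * cos t + sin t ^ 1 * sin (x * sin t) := by
    intro t
    push_cast
    rw [one_mul, cos_sub]; ring
  simp_rw [h2]
  rw [intervalIntegral.integral_add, h1, zero_add]
  · exact (by fun_prop : Continuous fun t => cos (x * sin t) * cos t).intervalIntegrable _ _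
  · exact (by fun_prop : Continuous fun t => sin t ^ 1 * sin (x * sin t)).intervalIntegrable _ _

lemma besselJ_one_fun : besselJ 1 = IS 1 := funext besselJ_one

lemma besselJd_one (x : ℝ) : besselJd 1 x = IC 2 x := by
  unfold besselJd
  rw [besselJ_one_fun]
  exact (hasDerivAt_IS 1 x).deriv

lemma w0 : (∫ t in (0:ℝ)..(2 * π), sin t ^ 0) = 2 * π := by simp
lemma w2 : (∫ t in (0:ℝ)..(2 * π), sin t ^ 2) = π := by
  rw [integral_sin_pow (n := 0), w0]; simp
lemma w4 : (∫ t in (0:ℝ)..(2 * π), sin t ^ 4) = 3 / 4 * π := by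
  rw [integral_sin_pow (n := 2), w2]; norm_num
lemma w6 : (∫ t in (0:ℝ)..(2 * π), sin t ^ 6) = 5 / 8 * π := by
  rw [integral_sin_pow (n := 4), w4]; simp; ring
lemma w8 : (∫ t in (0:ℝ)..(2 * π), sin t ^ 8) = 35 / 64 * π := by
  rw [integral_sin_pow (n := 6), w6]; simp; ring

lemma ii (k : ℕ) (c : ℝ) : IntervalIntegrable (fun t => c * sin t ^ k)
    MeasureTheory.volume 0 (2 * π) :=
  (by fun_prop : Continuous fun t => c * sin t ^ k).intervalIntegrable _ _

lemma poly3 (a b c : ℝ) (i j k : ℕ) :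
    (∫ t in (0:ℝ)..(2 * π), (a * sin t ^ i + b * sin t ^ j + c * sin t ^ k)) =
    a * (∫ t in (0:ℝ)..(2 * π), sin t ^ i) + b * (∫ t in (0:ℝ)..(2 * π), sin t ^ j)
      + c * (∫ t in (0:ℝ)..(2 * π), sin t ^ k) := by
  rw [intervalIntegral.integral_add ((ii i a).add (ii j b)) (ii k c),
    intervalIntegral.integral_add (ii i a) (ii j b)]
  simp only [intervalIntegral.integral_const_mul]

lemma avg_mono {f g : ℝ → ℝ} (hf : Continuous f) (hg : Continuous g) (h : ∀ t, f t ≤ g t) :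
    (1 / (2 * π)) * (∫ t in (0:ℝ)..(2 * π), f t) ≤ (1 / (2 * π)) * ∫ t in (0:ℝ)..(2 * π), g t :=
  mul_le_mul_of_nonneg_left (intervalIntegral.integral_mono_on (by positivity)
    (hf.intervalIntegrable _ _) (hg.intervalIntegrable _ _) fun t _ => h t) (by positivity)

lemma J_ge {x : ℝ} (hx : 0 ≤ x) : x / 2 - x ^ 3 / 16 ≤ IS 1 x := by
  have := avg_mono (f := fun t => x * sin t ^ 2 + (-(x ^ 3 / 6)) * sin t ^ 4 + 0 * sin t ^ 2)
    (g := fun t => sin t ^ 1 * sin (x * sin t)) (by fun_prop) (by fun_prop)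
    (fun t => by have := ssin_ge hx (sin t); rw [pow_one]; linarith)
  rw [poly3, w2, w4] at this
  refine le_trans (le_of_eq ?_) this
  field_simp; ring

lemma Jd_le (x : ℝ) : IC 2 x ≤ 1 / 2 - 3 * x ^ 2 / 16 + 5 * x ^ 4 / 384 := by
  have := avg_mono (f := fun t => sin t ^ 2 * cos (x * sin t))
    (g := fun t => 1 * sin t ^ 2 + (-(x ^ 2 / 2)) * sin t ^ 4 + (x ^ 4 / 24) * sin t ^ 6)
    (by fun_prop) (by fun_prop)
    (fun t => by
      have := mul_le_mul_of_nonneg_left (cos_le4 (x * sin t)) (sq_nonneg (sin t))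
      refine this.trans (le_of_eq ?_); ring)
  rw [poly3, w2, w4, w6] at this
  refine le_trans this (le_of_eq ?_)
  field_simp; ring

lemma Jd_ge (x : ℝ) : 1 / 2 - 3 * x ^ 2 / 16 ≤ IC 2 x := by
  have := avg_mono (g := fun t => sin t ^ 2 * cos (x * sin t))
    (f := fun t => 1 * sin t ^ 2 + (-(x ^ 2 / 2)) * sin t ^ 4 + 0 * sin t ^ 6)
    (by fun_prop) (by fun_prop)
    (fun t => by
      have := mul_le_mul_of_nonneg_left (one_sub_sq_div_two_le_cos (x := x * sin t))
        (sq_nonneg (sin t))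
      refine (le_of_eq ?_).trans this; ring)
  rw [poly3, w2, w4, w6] at this
  refine le_trans (le_of_eq ?_) this
  field_simp; ring

lemma S_le {x : ℝ} (hx : 0 ≤ x) :
    IS 3 x ≤ 3 * x / 8 - 5 * x ^ 3 / 96 + 7 * x ^ 5 / 3072 := by
  have := avg_mono (f := fun t => sin t ^ 3 * sin (x * sin t))
    (g := fun t => x * sin t ^ 4 + (-(x ^ 3 / 6)) * sin t ^ 6 + (x ^ 5 / 120) * sin t ^ 8)
    (by fun_prop) (by fun_prop)
    (fun t => by have := s3sin_le hx (sin t); linarith)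
  rw [poly3, w4, w6, w8] at this
  refine le_trans this (le_of_eq ?_)
  field_simp; ring

lemma betaHat_eq : betaHat = fun e => -3 * (1 - e ^ 2) * IS 1 e +
    e * ((2 - e ^ 2) * (1 - e ^ 2) + 1) * IC 2 e := by
  funext e
  rw [betaHat, besselJ_one, besselJd_one]

noncomputable def dB (e : ℝ) : ℝ := 6 * e * IS 1 e - 3 * (1 - e ^ 2) * IC 2 e +
    (3 - 9 * e ^ 2 + 5 * e ^ 4) * IC 2 e - e * (3 - 3 * e ^ 2 + e ^ 4) * IS 3 e

lemma hasDerivAt_beta (e : ℝ) : HasDerivAt betaHat (dB e) e := by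
  have hq : HasDerivAt (fun e : ℝ => e * ((2 - e ^ 2) * (1 - e ^ 2) + 1))
      (3 - 9 * e ^ 2 + 5 * e ^ 4) e := by
    have h : HasDerivAt (fun e : ℝ => 3 * e - 3 * e ^ 3 + e ^ 5) (3 - 9 * e ^ 2 + 5 * e ^ 4) e := by
      have := (((hasDerivAt_id e).const_mul 3).sub ((hasDerivAt_pow 3 e).const_mul 3)).add
        (hasDerivAt_pow 5 e)
      refine this.congr_deriv ?_
      push_cast; ring
    convert h using 1
    funext y; ring
  have hp : HasDerivAt (fun e : ℝ => -3 * (1 - e ^ 2)) (6 * e) e := by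
    have := ((hasDerivAt_pow 2 e).const_sub 1).const_mul (-3)
    refine this.congr_deriv ?_
    push_cast; ring
  rw [betaHat_eq]
  have := (hp.mul (hasDerivAt_IS 1 e)).add (hq.mul (hasDerivAt_IC 2 e))
  refine this.congr_deriv ?_
  unfold dB
  norm_num
  ring

lemma D_pos {e : ℝ} (h0 : 0 < e) (h1 : e ≤ 1) : 0 < e * dB e - 3 * betaHat e := by
  have hJ := J_ge h0.le
  have hd := Jd_le e
  have hS := S_le h0.le
  have hE : e * dB e - 3 * betaHat e = (9 - 3 * e ^ 2) * IS 1 e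
      - e * (9 - 3 * e ^ 2 - 2 * e ^ 4) * IC 2 e
      - e ^ 2 * (3 - 3 * e ^ 2 + e ^ 4) * IS 3 e := by
    rw [betaHat_eq, dB]; ring
  have hs1 : e ^ 2 ≤ 1 := by nlinarith
  have hs0 : 0 < e ^ 2 := by positivity
  have hs4 : e ^ 4 ≤ 1 := by nlinarith
  have a1 := mul_le_mul_of_nonneg_left hJ (by linarith : 0 ≤ 9 - 3 * e ^ 2)
  have a2 := mul_le_mul_of_nonneg_left hd
    (mul_nonneg h0.le (by linarith : 0 ≤ 9 - 3 * e ^ 2 - 2 * e ^ 4))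
  have a3 := mul_le_mul_of_nonneg_left hS
    (mul_nonneg hs0.le (by nlinarith [pow_pos h0 4] : 0 ≤ 3 - 3 * e ^ 2 + e ^ 4))
  rw [hE]
  have key : 0 < (9 - 3 * e ^ 2) * (e / 2 - e ^ 3 / 16)
      - e * (9 - 3 * e ^ 2 - 2 * e ^ 4) * (1 / 2 - 3 * e ^ 2 / 16 + 5 * e ^ 4 / 384)
      - e ^ 2 * (3 - 3 * e ^ 2 + e ^ 4) *
        (3 * e / 8 - 5 * e ^ 3 / 96 + 7 * e ^ 5 / 3072) := by
    have : 0 < e ^ 5 * (229/128 + (-895/1024) * e ^ 2 + (87/1024) * e ^ 4 + (-7/3072) * e ^ 6) := by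
      apply mul_pos (pow_pos h0 5)
      nlinarith [pow_pos h0 4, pow_pos h0 6, pow_pos h0 8,
        pow_le_one₀ (n := 4) h0.le h1, pow_le_one₀ (n := 6) h0.le h1, pow_le_one₀ (n := 8) h0.le h1]
    refine lt_of_lt_of_eq this ?_
    ring
  linarith

theorem main :
    ∃ e₀ ∈ Set.Ioo (0:ℝ) 1, betaHat e₀ = 0 ∧ deriv betaHat e₀ ≠ 0 ∧
      ∀ e ∈ Set.Ioo (0:ℝ) 1, betaHat e = 0 → e = e₀ := by
  have hc : Continuous betaHat :=
    continuous_iff_continuousAt.2 fun e => (hasDerivAt_beta e).continuousAt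
  have hhalf : betaHat (1 / 2) < 0 := by
    have hJ := J_ge (x := 1 / 2) (by norm_num)
    have hd := Jd_le (1 / 2)
    rw [betaHat_eq]
    norm_num at hJ hd ⊢
    linarith
  have hone : 0 < betaHat 1 := by
    have hd := Jd_ge 1
    rw [betaHat_eq]
    norm_num at hd ⊢
    linarith
  obtain ⟨e₀, ⟨hl, hr⟩, hz⟩ := intermediate_value_Icc (by norm_num : (1 / 2 : ℝ) ≤ 1)
    hc.continuousOn (show (0:ℝ) ∈ Icc (betaHat (1 / 2)) (betaHat 1) from ⟨hhalf.le, hone.le⟩)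
  have hp0 : 0 < e₀ := by linarith
  have hr' : e₀ < 1 := lt_of_le_of_ne hr (by rintro rfl; linarith)
  have hg : ∀ e : ℝ, 0 < e → HasDerivAt (fun e => betaHat e / e ^ 3)
      ((e * dB e - 3 * betaHat e) / e ^ 4) e := by
    intro e he
    have := (hasDerivAt_beta e).div (hasDerivAt_pow 3 e) (by positivity)
    refine this.congr_deriv ?_
    push_cast
    field_simp
  have hm : StrictMonoOn (fun e => betaHat e / e ^ 3) (Ioo 0 1) := by
    apply strictMonoOn_of_deriv_pos (convex_Ioo 0 1)
    · exact fun x hx => (hg x hx.1).continuousAt.continuousWithinAt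
    · intro x hx
      rw [interior_Ioo] at hx
      rw [(hg x hx.1).deriv]
      exact div_pos (D_pos hx.1 hx.2.le) (pow_pos hx.1 4)
  refine ⟨e₀, ⟨hp0, hr'⟩, hz, ?_, ?_⟩
  · rw [(hasDerivAt_beta e₀).deriv]
    intro h
    have := D_pos hp0 hr
    rw [h, hz] at this
    simp at this
  · intro e he hez
    apply hm.injOn he ⟨hp0, hr'⟩
    simp [hez, hz]

end BH

theorem stmt_6 :
    ∃ e₀ ∈ Set.Ioo (0:ℝ) 1, betaHat e₀ = 0 ∧ deriv betaHat e₀ ≠ 0 ∧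
      ∀ e ∈ Set.Ioo (0:ℝ) 1, betaHat e = 0 → e = e₀ := BH.main
end

section
/- The function f̂(e) := (−e⁶ + 3e⁴ + e³ − 3e² − 6e)J₀(e) + (e⁵ + 2e⁴ − 6e³ − 5e² + 6e + 12)J₁(e) is negative for every e in the interval 0 < e < 1. -/
open Real Set

lemma int_sin2 : ∫ t in (0:ℝ)..(2 * π), sin t ^ 2 = π := by
  rw [integral_sin_sq]; simp

lemma int_sin4 : ∫ t in (0:ℝ)..(2 * π), sin t ^ 4 = 3 / 4 * π := by
  have h := integral_sin_pow (a := 0) (b := 2 * π) 2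
  norm_num at h
  rw [h]
  try ring

lemma int_sin6 : ∫ t in (0:ℝ)..(2 * π), sin t ^ 6 = 5 / 8 * π := by
  have h := integral_sin_pow (a := 0) (b := 2 * π) 4
  rw [int_sin4] at h
  norm_num at h
  rw [h]; ring

lemma J0_lower (e : ℝ) : 1 - e ^ 2 / 4 ≤ besselJ 0 e := by
  have h : ∫ t in (0:ℝ)..(2 * π), (1 - e ^ 2 / 2 * sin t ^ 2) ≤
      ∫ t in (0:ℝ)..(2 * π), cos (((0:ℤ):ℝ) * t - e * sin t) := by
    apply intervalIntegral.integral_mono_on (by positivity)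
    · apply Continuous.intervalIntegrable; fun_prop
    · apply Continuous.intervalIntegrable; fun_prop
    · intro t _
      have := one_sub_sq_div_two_le_cos (x := ((0:ℤ):ℝ) * t - e * sin t)
      push_cast at this ⊢
      linarith [this]
  rw [intervalIntegral.integral_sub (Continuous.intervalIntegrable (by fun_prop) _ _)
    (Continuous.intervalIntegrable (by fun_prop) _ _), intervalIntegral.integral_const_mul,
    int_sin2] at h
  simp only [intervalIntegral.integral_const, smul_eq_mul] at h
  unfold besselJ
  have hp := pi_pos
  rw [one_div, ← div_eq_inv_mul, le_div_iff₀ (by positivity)]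
  linarith

lemma J1_upper (e : ℝ) (h0 : 0 < e) (h1 : e < 1) :
    besselJ 1 e ≤ e / 2 - e ^ 3 / 16 + e ^ 5 / 320 := by
  have hz : ∫ t in (0:ℝ)..(2 * π), cos (e * sin t) * cos t = 0 := by
    have := intervalIntegral.integral_comp_mul_deriv (a := 0) (b := 2 * π) (f := sin) (f' := cos)
      (g := fun s => cos (e * s)) (fun x _ => hasDerivAt_sin x) (by fun_prop) (by fun_prop)
    simpa using this
  have h : ∫ t in (0:ℝ)..(2 * π), cos (((1:ℤ):ℝ) * t - e * sin t) ≤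
      ∫ t in (0:ℝ)..(2 * π), (cos (e * sin t) * cos t +
        (e * sin t ^ 2 - e ^ 3 / 6 * sin t ^ 4 + e ^ 5 / 100 * sin t ^ 6)) := by
    apply intervalIntegral.integral_mono_on (by positivity)
    · apply Continuous.intervalIntegrable; fun_prop
    · apply Continuous.intervalIntegrable; fun_prop
    · intro t _
      have ha : |e * sin t| ≤ 1 := by
        rw [abs_mul, abs_of_pos h0]
        nlinarith [abs_sin_le_one t, abs_nonneg (sin t)]
      have hb := sin_bound ha
      have hc : sin t * (sin (e * sin t) - (e * sin t - (e * sin t) ^ 3 / 6)) ≤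
          e ^ 5 / 100 * sin t ^ 6 := by
        calc _ ≤ |sin t * (sin (e * sin t) - (e * sin t - (e * sin t) ^ 3 / 6))| := le_abs_self _
          _ = |sin t| * |sin (e * sin t) - (e * sin t - (e * sin t) ^ 3 / 6)| := abs_mul _ _
          _ ≤ |sin t| * (|e * sin t| ^ 5 / 100) := by gcongr
          _ = e ^ 5 / 100 * |sin t| ^ 6 := by rw [abs_mul, abs_of_pos h0]; ring
          _ = _ := by rw [Even.pow_abs (by decide)]
      push_cast
      rw [one_mul, cos_sub]
      linarith
  rw [intervalIntegral.integral_add (Continuous.intervalIntegrable (by fun_prop) _ _)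
    (Continuous.intervalIntegrable (by fun_prop) _ _), hz,
    intervalIntegral.integral_add (Continuous.intervalIntegrable (by fun_prop) _ _)
    (Continuous.intervalIntegrable (by fun_prop) _ _),
    intervalIntegral.integral_sub (Continuous.intervalIntegrable (by fun_prop) _ _)
    (Continuous.intervalIntegrable (by fun_prop) _ _),
    intervalIntegral.integral_const_mul, intervalIntegral.integral_const_mul,
    intervalIntegral.integral_const_mul,
    int_sin2, int_sin4, int_sin6] at h
  unfold besselJ
  have hp := pi_pos
  rw [one_div, ← div_eq_inv_mul, div_le_iff₀ (by positivity)]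
  linarith

/-- The function `f̂(e) = (−e⁶+3e⁴+e³−3e²−6e)J₀(e) + (e⁵+2e⁴−6e³−5e²+6e+12)J₁(e)`
is negative for every `e ∈ (0,1)`. -/
theorem stmt_8 (e : ℝ) (he : e ∈ Set.Ioo (0:ℝ) 1) :
    (-e ^ 6 + 3 * e ^ 4 + e ^ 3 - 3 * e ^ 2 - 6 * e) * besselJ 0 e +
      (e ^ 5 + 2 * e ^ 4 - 6 * e ^ 3 - 5 * e ^ 2 + 6 * e + 12) * besselJ 1 e < 0 := by
  obtain ⟨h0, h1⟩ := he
  have hJ0 := J0_lower e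
  have hJ1 := J1_upper e h0 h1
  have p2 : e ^ 2 < 1 := by nlinarith
  have p3 : e ^ 3 < 1 := by nlinarith
  have p4 : e ^ 4 < e := by nlinarith
  have hA : -e ^ 6 + 3 * e ^ 4 + e ^ 3 - 3 * e ^ 2 - 6 * e ≤ 0 := by
    have : 0 < e ^ 6 := by positivity
    nlinarith
  have hB : 0 ≤ e ^ 5 + 2 * e ^ 4 - 6 * e ^ 3 - 5 * e ^ 2 + 6 * e + 12 := by
    have : 0 < e ^ 5 := by positivity
    have : 0 < e ^ 4 := by positivity
    nlinarith
  have a := mul_le_mul_of_nonpos_left hJ0 hA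
  have b := mul_le_mul_of_nonneg_left hJ1 hB
  refine lt_of_le_of_lt (add_le_add a b) ?_
  have hd : 0 < 1 - e := by linarith
  have q0 : 0 ≤ e ^ 0 * (1 - e) ^ 7 := by positivity
  have q1 : 0 ≤ e ^ 1 * (1 - e) ^ 6 := by positivity
  have q2 : 0 ≤ e ^ 2 * (1 - e) ^ 5 := by positivity
  have q3 : 0 ≤ e ^ 3 * (1 - e) ^ 4 := by positivity
  have q4 : 0 ≤ e ^ 4 * (1 - e) ^ 3 := by positivity
  have q5 : 0 ≤ e ^ 5 * (1 - e) ^ 2 := by positivity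
  have q6 : 0 ≤ e ^ 6 * (1 - e) ^ 1 := by positivity
  have q7 : 0 ≤ e ^ 7 * (1 - e) ^ 0 := by positivity
  have key : -3 / 4 + 3 / 8 * e + 11 / 10 * e ^ 2 - 137 / 160 * e ^ 3 - 9 / 64 * e ^ 4
      + 27 / 160 * e ^ 5 + 1 / 160 * e ^ 6 + 1 / 320 * e ^ 7 < 0 := by
    nlinarith only [q0, q1, q2, q3, q4, q5, q6, q7]
  have h3 : 0 < e ^ 3 := by positivity
  have := mul_neg_of_pos_of_neg h3 key
  linarith
end

section
/- The function e ↦ e·J₁(e)/J₂(e) is strictly monotone decreasing on the interval 0 < e < 1 (note that J₂ has no zero on this interval, its first positive zero exceeding 1). -/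
open Real Set

lemma bes_int (n : ℤ) (x : ℝ) (a b : ℝ) : IntervalIntegrable
    (fun t => Real.cos (n * t - x * Real.sin t)) MeasureTheory.volume a b := by
  apply Continuous.intervalIntegrable
  fun_prop

lemma bes_rec (n : ℤ) (x : ℝ) :
    n * besselJ n x = x / 2 * (besselJ (n - 1) x + besselJ (n + 1) x) := by
  have h : ∫ t in (0:ℝ)..(2 * π), (Real.cos (n * t - x * Real.sin t) * (n - x * Real.cos t)) = 0 := by
    have hd : ∀ t ∈ Set.uIcc (0:ℝ) (2 * π), HasDerivAt (fun t : ℝ => Real.sin (n * t - x * Real.sin t))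
        (Real.cos (n * t - x * Real.sin t) * (n - x * Real.cos t)) t := by
      intro t _
      have h1 : HasDerivAt (fun t : ℝ => n * t - x * Real.sin t) (n * 1 - x * Real.cos t) t :=
        ((hasDerivAt_id t).const_mul (n : ℝ)).sub ((Real.hasDerivAt_sin t).const_mul x)
      simpa using h1.sin
    rw [intervalIntegral.integral_eq_sub_of_hasDerivAt hd
      (Continuous.intervalIntegrable (by fun_prop) _ _)]
    have e : (n : ℝ) * (2 * π) = ((2 * n : ℤ) : ℝ) * π := by push_cast; ring
    simp only [Real.sin_two_pi, mul_zero, sub_zero, Real.sin_zero, e, Real.sin_int_mul_pi]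
  have h2 : ∀ t : ℝ, Real.cos (n * t - x * Real.sin t) * (n - x * Real.cos t) =
      n * Real.cos (n * t - x * Real.sin t) -
      (x / 2 * Real.cos ((n - 1 : ℤ) * t - x * Real.sin t) +
       x / 2 * Real.cos ((n + 1 : ℤ) * t - x * Real.sin t)) := by
    intro t
    have e1 : ((n - 1 : ℤ) : ℝ) * t - x * Real.sin t = (n * t - x * Real.sin t) - t := by
      push_cast; ring
    have e2 : ((n + 1 : ℤ) : ℝ) * t - x * Real.sin t = (n * t - x * Real.sin t) + t := by
      push_cast; ring
    rw [e1, e2, Real.cos_sub _ t, Real.cos_add _ t]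
    ring
  simp_rw [h2] at h
  rw [intervalIntegral.integral_sub ((bes_int _ _ _ _).const_mul _)
    (((bes_int _ _ _ _).const_mul _).add ((bes_int _ _ _ _).const_mul _)),
    intervalIntegral.integral_add ((bes_int _ _ _ _).const_mul _) ((bes_int _ _ _ _).const_mul _)] at h
  simp only [intervalIntegral.integral_const_mul] at h
  unfold besselJ
  linear_combination (1 / (2 * π)) * h

lemma bes_deriv (n : ℤ) (x : ℝ) :
    HasDerivAt (besselJ n) ((besselJ (n - 1) x - besselJ (n + 1) x) / 2) x := by
  have h := (intervalIntegral.hasDerivAt_integral_of_dominated_loc_of_deriv_le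
    (μ := MeasureTheory.volume) (a := 0) (b := 2 * π)
    (F := fun (x t : ℝ) => Real.cos (n * t - x * Real.sin t))
    (F' := fun (x t : ℝ) => Real.sin (n * t - x * Real.sin t) * Real.sin t)
    (x₀ := x) (s := Set.univ) (bound := fun _ => 1) Filter.univ_mem
    (Filter.Eventually.of_forall fun y => (by fun_prop : Continuous _).aestronglyMeasurable)
    (bes_int n x _ _)
    ((by fun_prop : Continuous _).aestronglyMeasurable)
    (Filter.Eventually.of_forall fun t _ y _ => by
      rw [norm_mul]
      exact mul_le_one₀ (Real.abs_sin_le_one _) (norm_nonneg _) (Real.abs_sin_le_one _))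
    intervalIntegrable_const
    (Filter.Eventually.of_forall fun t _ y _ => by
      have h1 : HasDerivAt (fun y : ℝ => n * t - y * Real.sin t) (- (1 * Real.sin t)) y :=
        ((hasDerivAt_id y).mul_const (Real.sin t)).const_sub _
      refine HasDerivAt.congr_deriv (f := _) (h1.cos) ?_
      ring)).2
  have h3 := h.const_mul (1 / (2 * π))
  have h2 : ∀ t : ℝ, Real.sin (n * t - x * Real.sin t) * Real.sin t =
      (1 / 2 * Real.cos ((n - 1 : ℤ) * t - x * Real.sin t) -
       1 / 2 * Real.cos ((n + 1 : ℤ) * t - x * Real.sin t)) := by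
    intro t
    have e1 : ((n - 1 : ℤ) : ℝ) * t - x * Real.sin t = (n * t - x * Real.sin t) - t := by
      push_cast; ring
    have e2 : ((n + 1 : ℤ) : ℝ) * t - x * Real.sin t = (n * t - x * Real.sin t) + t := by
      push_cast; ring
    rw [e1, e2, Real.cos_sub _ t, Real.cos_add _ t]
    ring
  simp_rw [h2] at h3
  rw [intervalIntegral.integral_sub ((bes_int _ _ _ _).const_mul _)
    ((bes_int _ _ _ _).const_mul _)] at h3
  simp only [intervalIntegral.integral_const_mul] at h3
  refine HasDerivAt.congr_deriv (f := _) (h3) ?_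
  unfold besselJ
  ring

lemma bes0_pos (x : ℝ) (hx : x ∈ Set.Ioo (0:ℝ) 1) : 0 < besselJ 0 x := by
  unfold besselJ
  apply mul_pos (by positivity)
  apply intervalIntegral.intervalIntegral_pos_of_pos (bes_int 0 x _ _) _ (by positivity)
  intro t
  have h1 := Real.abs_sin_le_one t
  have h2 : |x * Real.sin t| ≤ 1 := by
    rw [abs_mul, abs_of_pos hx.1]
    nlinarith [abs_nonneg (Real.sin t), hx.2, hx.1]
  have := abs_le.1 h2
  have := Real.pi_gt_three
  apply Real.cos_pos_of_mem_Ioo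
  constructor <;> push_cast <;> linarith

lemma pos_of_deriv {f f' : ℝ → ℝ} (hf : ∀ x, HasDerivAt f (f' x) x) (h0 : f 0 = 0)
    (hp : ∀ x ∈ Set.Ioo (0:ℝ) 1, 0 < f' x) : ∀ x ∈ Set.Ioo (0:ℝ) 1, 0 < f x := by
  intro x hx
  have hm : StrictMonoOn f (Set.Icc 0 1) := by
    apply strictMonoOn_of_deriv_pos (convex_Icc 0 1)
    · exact fun y _ => (hf y).continuousAt.continuousWithinAt
    · intro y hy
      rw [interior_Icc] at hy
      rw [(hf y).deriv]
      exact hp y hy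
  have := hm ⟨le_rfl, zero_le_one⟩ ⟨hx.1.le, hx.2.le⟩ hx.1
  rwa [h0] at this

theorem stmt_9 :
    (∀ e ∈ Set.Ioo (0:ℝ) 1, besselJ 2 e ≠ 0) ∧
    StrictAntiOn (fun e => e * besselJ 1 e / besselJ 2 e) (Set.Ioo (0:ℝ) 1) := by
  have d1 : ∀ x, HasDerivAt (besselJ 1) ((besselJ 0 x - besselJ 2 x) / 2) x := fun x => by
    simpa using bes_deriv 1 x
  have d2 : ∀ x, HasDerivAt (besselJ 2) ((besselJ 1 x - besselJ 3 x) / 2) x := fun x => by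
    simpa using bes_deriv 2 x
  have r1 : ∀ x, besselJ 1 x = x / 2 * (besselJ 0 x + besselJ 2 x) := fun x => by
    simpa using bes_rec 1 x
  have r2 : ∀ x, 2 * besselJ 2 x = x / 2 * (besselJ 1 x + besselJ 3 x) := fun x => by
    simpa using bes_rec 2 x
  have p1 : ∀ x ∈ Set.Ioo (0:ℝ) 1, 0 < besselJ 1 x := by
    intro x hx
    have := pos_of_deriv (f := fun x => x * besselJ 1 x) (f' := fun x => x * besselJ 0 x)
      (fun y => by
        refine HasDerivAt.congr_deriv (f := _) ((hasDerivAt_id y).mul (d1 y)) ?_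
        simp only [id]
        linear_combination r1 y) (by simp) (fun y hy => mul_pos hy.1 (bes0_pos y hy)) x hx
    exact pos_of_mul_pos_right this hx.1.le
  have p2 : ∀ x ∈ Set.Ioo (0:ℝ) 1, 0 < besselJ 2 x := by
    intro x hx
    have := pos_of_deriv (f := fun x => x ^ 2 * besselJ 2 x) (f' := fun x => x ^ 2 * besselJ 1 x)
      (fun y => by
        refine HasDerivAt.congr_deriv (f := _) ((hasDerivAt_pow 2 y).mul (d2 y)) ?_
        push_cast
        linear_combination y * (r2 y)) (by simp)
        (fun y hy => mul_pos (pow_pos hy.1 2) (p1 y hy)) x hx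
    exact pos_of_mul_pos_right this (by positivity)
  have pE : ∀ x ∈ Set.Ioo (0:ℝ) 1,
      0 < x ^ 2 * besselJ 1 x ^ 2 + x ^ 2 * besselJ 2 x ^ 2 - 4 * (x * (besselJ 1 x * besselJ 2 x)) := by
    apply pos_of_deriv (f := fun x => x ^ 2 * besselJ 1 x ^ 2 + x ^ 2 * besselJ 2 x ^ 2
      - 4 * (x * (besselJ 1 x * besselJ 2 x))) (f' := fun x => 2 * x * besselJ 2 x ^ 2)
    · intro y
      have hA := (hasDerivAt_pow 2 y).mul ((d1 y).pow 2)
      have hB := (hasDerivAt_pow 2 y).mul ((d2 y).pow 2)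
      have hC := ((hasDerivAt_id y).mul ((d1 y).mul (d2 y))).const_mul 4
      refine HasDerivAt.congr_deriv (f := _) ((hA.add hB).sub hC) ?_
      simp only [id, Pi.mul_apply, Pi.pow_apply]
      push_cast
      linear_combination (-2 * y * besselJ 1 y + 4 * besselJ 2 y) * r1 y +
        (2 * y * besselJ 2 y - 4 * besselJ 1 y) * r2 y
    · simp
    · intro y hy
      have := p2 y hy
      have := hy.1
      positivity
  refine ⟨fun e he => (p2 e he).ne', ?_⟩
  have hd : ∀ x ∈ Set.Ioo (0:ℝ) 1, HasDerivAt (fun e => e * besselJ 1 e / besselJ 2 e)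
      (((1 * besselJ 1 x + x * ((besselJ 0 x - besselJ 2 x) / 2)) * besselJ 2 x
        - x * besselJ 1 x * ((besselJ 1 x - besselJ 3 x) / 2)) / besselJ 2 x ^ 2) x := by
    intro x hx
    exact ((hasDerivAt_id x).mul (d1 x)).div (d2 x) (p2 x hx).ne'
  apply strictAntiOn_of_deriv_neg (convex_Ioo 0 1)
  · exact fun y hy => (hd y hy).continuousAt.continuousWithinAt
  · intro x hx
    rw [interior_Ioo] at hx
    rw [(hd x hx).deriv]
    have := p2 x hx
    apply div_neg_of_neg_of_pos _ (by positivity)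
    have hE := pE x hx
    have hx0 := hx.1
    have key : x * ((1 * besselJ 1 x + x * ((besselJ 0 x - besselJ 2 x) / 2)) * besselJ 2 x
        - x * besselJ 1 x * ((besselJ 1 x - besselJ 3 x) / 2)) = -(x ^ 2 * besselJ 1 x ^ 2
        + x ^ 2 * besselJ 2 x ^ 2 - 4 * (x * (besselJ 1 x * besselJ 2 x))) := by
      linear_combination (-x * besselJ 2 x) * r1 x + (-x * besselJ 1 x) * r2 x
    nlinarith
end

section
/- For every integer m ≥ 2 and every e ∈ (0,1), one has B_m'(e) > A_m'(e); equivalently, the function G_m(e) := m²e³(B_m'(e) − A_m'(e)) is positive on the interval 0 < e < 1. -/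
open Real Set

theorem bj_hasDerivAt (n : ℤ) (x : ℝ) : HasDerivAt (besselJ n)
    ((1 / (2 * π)) * ∫ t in (0:ℝ)..(2 * π), Real.sin (n * t - x * Real.sin t) * Real.sin t) x := by
  unfold besselJ
  refine HasDerivAt.const_mul _ ?_
  refine (intervalIntegral.hasDerivAt_integral_of_dominated_loc_of_deriv_le
    (μ := MeasureTheory.volume) (a := 0) (b := 2 * π) (bound := fun _ => 1)
    (F := fun x t => Real.cos (n * t - x * Real.sin t))
    (F' := fun x t => Real.sin (n * t - x * Real.sin t) * Real.sin t)
    (s := Set.univ) Filter.univ_mem ?_ ?_ ?_ ?_ ?_ ?_).2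
  · refine Filter.Eventually.of_forall fun y => ?_
    exact (by fun_prop : Continuous fun t => Real.cos (n * t - y * Real.sin t)).aestronglyMeasurable
  · exact (by fun_prop : Continuous fun t => Real.cos (n * t - x * Real.sin t)).intervalIntegrable _ _
  · exact (by fun_prop : Continuous fun t =>
      Real.sin (n * t - x * Real.sin t) * Real.sin t).aestronglyMeasurable
  · refine Filter.Eventually.of_forall fun t _ y _ => ?_
    rw [norm_mul]
    exact mul_le_one₀ (Real.abs_sin_le_one _) (norm_nonneg _) (Real.abs_sin_le_one _)
  · exact intervalIntegrable_const
  · refine Filter.Eventually.of_forall fun t _ y _ => ?_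
    have h : HasDerivAt (fun y : ℝ => n * t - y * Real.sin t) (-(1 * Real.sin t)) y :=
      ((hasDerivAt_id y).mul_const (Real.sin t)).const_sub _
    refine HasDerivAt.congr_deriv h.cos ?_
    ring

theorem bj_d (n : ℤ) (x : ℝ) : besselJd n x =
    (1 / (2 * π)) * ∫ t in (0:ℝ)..(2 * π), Real.sin (n * t - x * Real.sin t) * Real.sin t :=
  (bj_hasDerivAt n x).deriv

theorem bj_hd (n : ℤ) (x : ℝ) : HasDerivAt (besselJ n) (besselJd n x) x := by
  rw [bj_d]; exact bj_hasDerivAt n x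

theorem bj_parts (n : ℤ) (x : ℝ) :
    n * besselJ n x = x * ((1 / (2 * π)) *
      ∫ t in (0:ℝ)..(2 * π), Real.cos (n * t - x * Real.sin t) * Real.cos t) := by
  have h0 : ∫ t in (0:ℝ)..(2 * π), Real.cos (n * t - x * Real.sin t) * (n - x * Real.cos t) = 0 := by
    rw [intervalIntegral.integral_eq_sub_of_hasDerivAt
      (f := fun t => Real.sin (n * t - x * Real.sin t))]
    · have : (n:ℝ) * (2 * π) - x * Real.sin (2 * π) = n * (2 * π) := by simp
      simp only [this]
      have h2 := Real.sin_int_mul_pi (2 * n)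
      push_cast at h2
      rw [show (n:ℝ) * (2 * π) = 2 * n * π by ring, h2]
      simp
    · intro t _
      have h : HasDerivAt (fun t : ℝ => n * t - x * Real.sin t) (n * 1 - x * Real.cos t) t :=
        ((hasDerivAt_id t).const_mul _).sub ((Real.hasDerivAt_sin t).const_mul x)
      simpa using h.sin
    · exact (by fun_prop : Continuous fun t =>
        Real.cos (n * t - x * Real.sin t) * (n - x * Real.cos t)).intervalIntegrable _ _
  have h1 : ∫ t in (0:ℝ)..(2 * π), Real.cos (n * t - x * Real.sin t) * (n - x * Real.cos t)
      = n * (∫ t in (0:ℝ)..(2 * π), Real.cos (n * t - x * Real.sin t))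
        - x * ∫ t in (0:ℝ)..(2 * π), Real.cos (n * t - x * Real.sin t) * Real.cos t := by
    rw [← intervalIntegral.integral_const_mul, ← intervalIntegral.integral_const_mul,
      ← intervalIntegral.integral_sub]
    · congr 1; ext t; ring
    · exact (by fun_prop : Continuous fun t =>
        (n:ℝ) * Real.cos (n * t - x * Real.sin t)).intervalIntegrable _ _
    · exact (by fun_prop : Continuous fun t =>
        x * (Real.cos (n * t - x * Real.sin t) * Real.cos t)).intervalIntegrable _ _
  unfold besselJ
  rw [h0] at h1
  linear_combination (-(1 / (2 * π))) * h1

theorem bj_pm (n k : ℤ) (x : ℝ) (hk : (k:ℝ) ^ 2 = 1) : besselJ (n - k) x =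
    (1 / (2 * π)) * (∫ t in (0:ℝ)..(2 * π), Real.cos (n * t - x * Real.sin t) * Real.cos t)
    + k * besselJd n x := by
  rw [bj_d]
  have : ∫ t in (0:ℝ)..(2 * π), Real.cos (((n - k : ℤ):ℝ) * t - x * Real.sin t)
     = (∫ t in (0:ℝ)..(2 * π), Real.cos (n * t - x * Real.sin t) * Real.cos t)
       + k * ∫ t in (0:ℝ)..(2 * π), Real.sin (n * t - x * Real.sin t) * Real.sin t := by
    rw [← intervalIntegral.integral_const_mul, ← intervalIntegral.integral_add]
    · congr 1; ext t
      have h3 : (k:ℝ) = 1 ∨ (k:ℝ) = -1 := by simpa using hk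
      push_cast
      rw [show ((n:ℝ) - k) * t - x * Real.sin t = (n * t - x * Real.sin t) - k * t by ring,
        Real.cos_sub]
      rcases h3 with h | h <;> rw [h] <;> simp
    · exact (by fun_prop : Continuous fun t =>
        Real.cos (n * t - x * Real.sin t) * Real.cos t).intervalIntegrable _ _
    · exact (by fun_prop : Continuous fun t =>
        (k:ℝ) * (Real.sin (n * t - x * Real.sin t) * Real.sin t)).intervalIntegrable _ _
  unfold besselJ
  rw [this]; ring

theorem bj_rec1 (n : ℤ) (x : ℝ) : x * besselJ (n - 1) x = n * besselJ n x + x * besselJd n x := by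
  rw [bj_parts, bj_pm n 1 x (by norm_num)]; push_cast; ring

theorem bj_rec2 (n : ℤ) (x : ℝ) : x * besselJ (n + 1) x = n * besselJ n x - x * besselJd n x := by
  rw [bj_parts]
  have := bj_pm n (-1) x (by norm_num)
  rw [sub_neg_eq_add] at this
  rw [this]; push_cast; ring

theorem bj_cont (n : ℤ) : Continuous (besselJ n) :=
  continuous_iff_continuousAt.2 fun x => (bj_hd n x).continuousAt

theorem bj_zero (n : ℤ) (hn : n ≠ 0) : besselJ n 0 = 0 := by
  have := bj_parts n 0
  rw [zero_mul] at this
  exact (mul_eq_zero.1 this).resolve_left (by exact_mod_cast hn)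

theorem bj_small : ∃ d > 0, ∀ n : ℕ, ∀ x ∈ Ioo (0:ℝ) d, 0 < besselJ n x := by
  have h0 : besselJ 0 0 = 1 := by
    unfold besselJ
    simp
    field_simp
  have hev : ∀ᶠ x in nhds (0:ℝ), 0 < besselJ 0 x := by
    apply (bj_cont 0).continuousAt.eventually_const_lt
    rw [h0]; norm_num
  obtain ⟨d, hd, h⟩ := Metric.eventually_nhds_iff.1 hev
  refine ⟨d, hd, fun n => ?_⟩
  induction n with
  | zero =>
    intro x hx
    apply h
    rw [Real.dist_eq, sub_zero, abs_of_pos hx.1]; exact hx.2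
  | succ k ih =>
    intro x hx
    have hder : ∀ u : ℝ, HasDerivAt (fun u => u ^ (k+1) * besselJ ((k+1 : ℕ):ℤ) u)
        (u ^ (k+1) * besselJ (k:ℤ) u) u := by
      intro u
      have h1 := (hasDerivAt_pow (k+1) u).mul (bj_hd ((k+1 : ℕ):ℤ) u)
      have h2 := bj_rec1 ((k+1 : ℕ):ℤ) u
      rw [show (((k+1 : ℕ):ℤ) - 1) = (k:ℤ) by push_cast; ring] at h2
      refine HasDerivAt.congr_deriv h1 ?_
      push_cast at h2 ⊢
      linear_combination -u ^ k * h2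
    have hm : StrictMonoOn (fun u => u ^ (k+1) * besselJ ((k+1 : ℕ):ℤ) u) (Icc 0 x) := by
      apply strictMonoOn_of_deriv_pos (convex_Icc 0 x)
      · exact fun u _ => (hder u).continuousAt.continuousWithinAt
      · intro u hu
        rw [interior_Icc] at hu
        rw [(hder u).deriv]
        exact mul_pos (pow_pos hu.1 _) (ih u ⟨hu.1, hu.2.trans hx.2⟩)
    have := hm (left_mem_Icc.2 hx.1.le) (right_mem_Icc.2 hx.1.le) hx.1
    simp only [ne_eq, Nat.add_eq_zero_iff, one_ne_zero, and_false, not_false_eq_true, zero_pow,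
      zero_mul] at this
    exact pos_of_mul_pos_right this (pow_nonneg hx.1.le _)

noncomputable def yy (m : ℕ) (e : ℝ) : ℝ := besselJ m (m * e)
noncomputable def zz (m : ℕ) (e : ℝ) : ℝ := e * besselJd m (m * e)

theorem yy_hd (m : ℕ) (e : ℝ) (he : 0 < e) : HasDerivAt (yy m) (m * zz m e / e) e := by
  have h1 : HasDerivAt (fun e : ℝ => (m:ℝ) * e) (m * 1) e := (hasDerivAt_id e).const_mul _
  have h := (bj_hd m (m * e)).comp e h1
  refine HasDerivAt.congr_deriv h ?_
  unfold zz; field_simp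

theorem zz_eq (m : ℕ) (hm : 1 ≤ m) (e : ℝ) :
    zz m e = e * besselJ (m - 1) (m * e) - besselJ m (m * e) := by
  have h := bj_rec1 m (m * e)
  have hm' : (m:ℝ) ≠ 0 := by positivity
  unfold zz
  apply mul_left_cancel₀ hm'
  push_cast at h
  linear_combination -h

theorem zz_hd (m : ℕ) (hm : 1 ≤ m) (e : ℝ) (he : 0 < e) :
    HasDerivAt (zz m) (m * (1 - e ^ 2) * yy m e / e) e := by
  have h1 : HasDerivAt (fun e : ℝ => (m:ℝ) * e) (m * 1) e := (hasDerivAt_id e).const_mul _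
  have ha := (bj_hd (m - 1) (m * e)).comp e h1
  have hb := (bj_hd m (m * e)).comp e h1
  have h := ((hasDerivAt_id e).mul ha).sub hb
  have h' : HasDerivAt (zz m) _ e := h.congr_of_eventuallyEq
    (Filter.Eventually.of_forall fun u => zz_eq m hm u)
  refine HasDerivAt.congr_deriv h' ?_
  have r1 := bj_rec1 m (m * e)
  have r2 := bj_rec2 (m - 1) (m * e)
  rw [sub_add_cancel] at r2
  push_cast at r1 r2
  have hm' : (m:ℝ) ≠ 0 := by positivity
  simp only [yy, id, Function.comp]
  rw [eq_div_iff he.ne']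
  linear_combination r1 + r2 * e

theorem yz_cont (m : ℕ) (hm : 1 ≤ m) : Continuous (yy m) ∧ Continuous (zz m) := by
  have h1 : Continuous (yy m) := by
    unfold yy; exact (bj_cont m).comp (by fun_prop)
  refine ⟨h1, ?_⟩
  have : zz m = fun e => e * besselJ (m - 1) (m * e) - besselJ m (m * e) :=
    funext (zz_eq m hm)
  rw [this]
  exact (continuous_id.mul ((bj_cont _).comp (by fun_prop))).sub h1

theorem yy_zero (m : ℕ) (hm : 1 ≤ m) : yy m 0 = 0 := by
  unfold yy; rw [mul_zero]; exact bj_zero _ (by omega)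

theorem zz_zero (m : ℕ) : zz m 0 = 0 := by unfold zz; rw [zero_mul]

theorem yz_nonneg (m : ℕ) (hm : 1 ≤ m) (e : ℝ) (he : e ∈ Ioo (0:ℝ) 1) :
    0 ≤ yy m e * zz m e := by
  have hmono : MonotoneOn (fun u => yy m u * zz m u) (Icc 0 e) := by
    apply monotoneOn_of_deriv_nonneg (convex_Icc 0 e)
    · exact ((yz_cont m hm).1.mul (yz_cont m hm).2).continuousOn
    · intro u hu
      rw [interior_Icc] at hu
      exact ((yy_hd m u hu.1).mul (zz_hd m hm u hu.1)).differentiableAt.differentiableWithinAt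
    · intro u hu
      rw [interior_Icc] at hu
      have hd : HasDerivAt (fun u => yy m u * zz m u) _ u :=
        (yy_hd m u hu.1).mul (zz_hd m hm u hu.1)
      rw [hd.deriv]
      have hu0 := hu.1
      have hu1 : 0 ≤ 1 - u ^ 2 := by nlinarith [hu.1, hu.2, he.2]
      have : m * zz m u / u * zz m u + yy m u * (m * (1 - u ^ 2) * yy m u / u)
        = m / u * (zz m u ^ 2 + (1 - u ^ 2) * yy m u ^ 2) := by ring
      rw [this]; positivity
  have := hmono (left_mem_Icc.2 he.1.le) (right_mem_Icc.2 he.1.le) he.1.le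
  simpa [zz_zero] using this

theorem yy_pos (m : ℕ) (hm : 1 ≤ m) (e : ℝ) (he : e ∈ Ioo (0:ℝ) 1) : 0 < yy m e := by
  obtain ⟨d, hd, h⟩ := bj_small
  have hm' : (0:ℝ) < m := by positivity
  have hsm : ∀ a, 0 < a → a < d / m → 0 < yy m a := by
    intro a ha0 ha
    refine h m _ ⟨by positivity, ?_⟩
    rw [lt_div_iff₀ hm'] at ha; linarith
  by_contra hcon
  push Not at hcon
  obtain ⟨a, ha0, ha⟩ := exists_between (lt_min he.1 (div_pos hd hm'))
  have hae := ha.trans_le (min_le_left _ _)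
  have hya := hsm a ha0 (ha.trans_le (min_le_right _ _))
  obtain ⟨c, hc, hc0⟩ := intermediate_value_Icc' hae.le (yz_cont m hm).1.continuousOn
    ⟨hcon, hya.le⟩
  have hmono : MonotoneOn (fun u => yy m u ^ 2) (Icc a c) := by
    apply monotoneOn_of_deriv_nonneg (convex_Icc a c)
    · exact ((yz_cont m hm).1.pow 2).continuousOn
    · intro u hu
      rw [interior_Icc] at hu
      exact ((yy_hd m u (ha0.trans hu.1)).pow 2).differentiableAt.differentiableWithinAt
    · intro u hu
      rw [interior_Icc] at hu
      have hu0 := ha0.trans hu.1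
      have hd : HasDerivAt (fun u => yy m u ^ 2) _ u := (yy_hd m u hu0).pow 2
      rw [hd.deriv]
      have := yz_nonneg m hm u ⟨hu0, by linarith [hu.2, hc.2, he.2]⟩
      have h3 : ((2:ℕ):ℝ) * yy m u ^ (2 - 1) * (m * zz m u / u)
        = 2 * m / u * (yy m u * zz m u) := by norm_num; ring
      rw [h3]; positivity
  have := hmono (left_mem_Icc.2 hc.1) (right_mem_Icc.2 hc.1) hc.1
  simp only [hc0] at this
  nlinarith

noncomputable def nN (m s : ℝ) : ℝ := 4 + 6 * m * s + 2 * m ^ 2 * s ^ 4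
noncomputable def eE (m s : ℝ) : ℝ := 2 * m ^ 2 * s ^ 4 + 2 * s ^ 2 + 2 + 5 * m * s + m * s ^ 3
noncomputable def rR (m s : ℝ) : ℝ := s * nN m s / eE m s
noncomputable def rRd (m s : ℝ) : ℝ :=
  ((nN m s + s * (6 * m + 8 * m ^ 2 * s ^ 3)) * eE m s
    - s * nN m s * (8 * m ^ 2 * s ^ 3 + 4 * s + 5 * m + 3 * m * s ^ 2)) / eE m s ^ 2

theorem eE_pos (m s : ℝ) (hm : 0 ≤ m) (hs : 0 ≤ s) : 0 < eE m s := by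
  unfold eE; positivity

theorem rR_hd (m s : ℝ) (hm : 0 ≤ m) (hs : 0 ≤ s) : HasDerivAt (rR m) (rRd m s) s := by
  have hi := hasDerivAt_id s
  have hN : HasDerivAt (nN m) (6 * m + 8 * m ^ 2 * s ^ 3) s := by
    have := (((hi.const_mul (6 * m)).const_add 4).add ((hi.pow 4).const_mul (2 * m ^ 2)))
    refine HasDerivAt.congr_deriv this ?_
    simp; ring
  have hE : HasDerivAt (eE m) (8 * m ^ 2 * s ^ 3 + 4 * s + 5 * m + 3 * m * s ^ 2) s := by
    have := ((((((hi.pow 4).const_mul (2 * m ^ 2)).add ((hi.pow 2).const_mul 2)).add_const 2).add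
      (hi.const_mul (5 * m))).add ((hi.pow 3).const_mul m))
    refine HasDerivAt.congr_deriv this ?_
    simp; ring
  have := (hi.mul hN).div hE (eE_pos m s hm hs).ne'
  refine HasDerivAt.congr_deriv this ?_
  simp [rRd]

theorem key (m s : ℝ) (hm : 0 < m) (hs : 0 < s) (hs1 : s < 1) :
    0 < m * s ^ 2 - m * rR m s ^ 2 + (1 - s ^ 2) / s * rRd m s := by
  have hE := eE_pos m s hm.le hs.le
  have : m * s ^ 2 - m * rR m s ^ 2 + (1 - s ^ 2) / s * rRd m s =
     (1 - s ^ 2) ^ 2 * (8 + 24 * m * s + 4 * m * s ^ 3 + m ^ 2 * s ^ 2 * (30 - 8 * s ^ 2)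
       + 5 * m ^ 3 * s ^ 5) / (s * eE m s ^ 2) := by
    unfold rR rRd
    have hE' := hE.ne'
    field_simp
    unfold eE nN
    ring
  rw [this]
  have h1 : 0 < 1 - s ^ 2 := by nlinarith
  have h2 : 0 < 30 - 8 * s ^ 2 := by nlinarith
  positivity

theorem sqrt_hd (e : ℝ) (he : e ∈ Ioo (0:ℝ) 1) :
    HasDerivAt (fun u : ℝ => √(1 - u ^ 2)) (-e / √(1 - e ^ 2)) e := by
  have h1 : 0 < 1 - e ^ 2 := by nlinarith [he.1, he.2]
  have := (((hasDerivAt_id e).pow 2).const_sub 1).sqrt (by simpa using h1.ne')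
  refine HasDerivAt.congr_deriv this ?_
  simp; field_simp

theorem main_ineq (m : ℕ) (hm : 1 ≤ m) (e : ℝ) (he : e ∈ Ioo (0:ℝ) 1) :
    rR m √(1 - e ^ 2) * yy m e < zz m e := by
  have hm' : (0:ℝ) < m := by positivity
  have hmono : StrictMonoOn
      (fun u => yy m u * zz m u - rR m √(1 - u ^ 2) * yy m u ^ 2) (Icc 0 e) := by
    apply strictMonoOn_of_deriv_pos (convex_Icc 0 e)
    · obtain ⟨hy, hz⟩ := yz_cont m hm
      refine ((hy.mul hz).sub (Continuous.mul ?_ (hy.pow 2))).continuousOn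
      rw [continuous_iff_continuousAt]
      intro u
      exact ContinuousAt.comp (f := fun u : ℝ => √(1 - u ^ 2))
        (rR_hd m _ hm'.le (Real.sqrt_nonneg (1 - u ^ 2))).continuousAt
        (by fun_prop : Continuous fun u : ℝ => √(1 - u ^ 2)).continuousAt
    · intro u hu
      rw [interior_Icc] at hu
      have hu' : u ∈ Ioo (0:ℝ) 1 := ⟨hu.1, hu.2.trans he.2⟩
      have h1 : 0 < 1 - u ^ 2 := by nlinarith [hu'.1, hu'.2]
      have hs := Real.sqrt_pos.2 h1
      have hss := Real.sq_sqrt h1.le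
      have hy := yy_hd m u hu.1
      have hz := zz_hd m hm u hu.1
      have hr := (rR_hd m _ hm'.le (Real.sqrt_nonneg (1 - u ^ 2))).comp u (sqrt_hd u hu')
      have hd : HasDerivAt (fun u => yy m u * zz m u - rR m √(1 - u ^ 2) * yy m u ^ 2) _ u :=
        (hy.mul hz).sub (hr.mul (hy.pow 2))
      rw [hd.deriv]
      have hs1 : √(1 - u ^ 2) < 1 := by nlinarith [hu.1, pow_pos hu.1 2]
      have hk := key m _ hm' hs hs1
      have hyp := yy_pos m hm u hu'
      set s := √(1 - u ^ 2) with hsdef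
      have hu2 : u ^ 2 = 1 - s ^ 2 := by linarith
      have hu0 := hu.1
      have : 0 < (1 / u) * (m * (zz m u - rR m s * yy m u) ^ 2 + yy m u ^ 2 *
          (m * s ^ 2 - m * rR m s ^ 2 + (1 - s ^ 2) / s * rRd m s)) := by positivity
      refine this.trans_eq ?_
      rw [← hu2, hss]
      simp only [Function.comp, ← hsdef]
      field_simp
      ring
  have := hmono (left_mem_Icc.2 he.1.le) (right_mem_Icc.2 he.1.le) he.1
  simp only [zz_zero, yy_zero m hm] at this
  have hyp := yy_pos m hm e he
  have h2 : 0 < yy m e * (zz m e - rR m √(1 - e ^ 2) * yy m e) := by nlinarith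
  linarith [pos_of_mul_pos_right h2 hyp.le]

theorem coefA_hd (m : ℕ) (hm : 1 ≤ m) (e : ℝ) (he : e ∈ Ioo (0:ℝ) 1) :
    HasDerivAt (coefA m) (4 / (m ^ 2 * e ^ 3) * (yy m e * (4 + 2 * m ^ 2 * (1 - e ^ 2) ^ 2)
      - m * (6 - e ^ 2) * zz m e)) e := by
  have hm' : (0:ℝ) < m := by positivity
  have he0 := he.1
  have hE : coefA m = fun e => (4 * (2 * m * (1 - e ^ 2) * zz m e - (2 - e ^ 2) * yy m e)) /
     ((m:ℝ) ^ 2 * e ^ 2) := by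
    funext e; unfold coefA yy zz; ring
  rw [hE]
  have hq := (hasDerivAt_id e).pow 2
  have h := (((((hq.const_sub 1).const_mul (2 * (m:ℝ))).mul (zz_hd m hm e he0)).sub
    ((hq.const_sub 2).mul (yy_hd m e he0))).const_mul 4).div (hq.const_mul ((m:ℝ) ^ 2))
    (by simp only [Pi.pow_apply, id]; positivity)
  refine HasDerivAt.congr_deriv h ?_
  simp
  field_simp
  ring

theorem coefB_hd (m : ℕ) (hm : 1 ≤ m) (e : ℝ) (he : e ∈ Ioo (0:ℝ) 1) :
    HasDerivAt (coefB m) (8 / (m ^ 2 * e ^ 3) * (-3 * m * √(1 - e ^ 2) * yy m e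
      + zz m e * (m ^ 2 * √(1 - e ^ 2) ^ 3 + √(1 - e ^ 2) + 1 / √(1 - e ^ 2)))) e := by
  have hm' : (0:ℝ) < m := by positivity
  have he0 := he.1
  have h1 : 0 < 1 - e ^ 2 := by nlinarith [he.1, he.2]
  have hs := Real.sqrt_pos.2 h1
  have hss := Real.sq_sqrt h1.le
  have hE : coefB m = fun e => (-8 * (√(1 - e ^ 2) * (zz m e - m * (1 - e ^ 2) * yy m e))) /
     ((m:ℝ) ^ 2 * e ^ 2) := by
    funext e; unfold coefB yy zz; ring
  rw [hE]
  have hq := (hasDerivAt_id e).pow 2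
  have h := (((sqrt_hd e he).mul ((zz_hd m hm e he0).sub
    (((hq.const_sub 1).const_mul (m:ℝ)).mul (yy_hd m e he0)))).const_mul (-8)).div
    (hq.const_mul ((m:ℝ) ^ 2)) (by simp only [Pi.pow_apply, id]; positivity)
  refine HasDerivAt.congr_deriv h ?_
  simp
  set s := √(1 - e ^ 2) with hsdef
  have hu2 : e ^ 2 = 1 - s ^ 2 := by linarith
  rw [hss.symm]
  field_simp
  rw [hu2]
  ring

theorem stmt_10 (m : ℕ) (hm : 2 ≤ m) (e : ℝ) (he : e ∈ Set.Ioo (0:ℝ) 1) :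
    deriv (coefA m) e < deriv (coefB m) e ∧
    0 < (m:ℝ) ^ 2 * e ^ 3 * (deriv (coefB m) e - deriv (coefA m) e) := by
  have hm1 : 1 ≤ m := by omega
  have hm' : (0:ℝ) < m := by positivity
  have he0 := he.1
  have h1 : 0 < 1 - e ^ 2 := by nlinarith [he.1, he.2]
  have hs := Real.sqrt_pos.2 h1
  have hss := Real.sq_sqrt h1.le
  have hmain := main_ineq m hm1 e he
  rw [(coefA_hd m hm1 e he).deriv, (coefB_hd m hm1 e he).deriv]
  set s := √(1 - e ^ 2) with hsdef
  have hE := eE_pos m s hm'.le hs.le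
  have hpos : 0 < 4 / (m ^ 2 * e ^ 3) * (eE m s / s * (zz m e - rR m s * yy m e)) := by
    have : 0 < zz m e - rR m s * yy m e := by linarith
    positivity
  have heq : 4 / (m ^ 2 * e ^ 3) * (eE m s / s * (zz m e - rR m s * yy m e)) =
      8 / (m ^ 2 * e ^ 3) * (-3 * m * s * yy m e
      + zz m e * (m ^ 2 * s ^ 3 + s + 1 / s)) -
      4 / (m ^ 2 * e ^ 3) * (yy m e * (4 + 2 * m ^ 2 * (1 - e ^ 2) ^ 2)
      - m * (6 - e ^ 2) * zz m e) := by
    have hu2 : 6 - e ^ 2 = 5 + s ^ 2 := by linarith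
    have hr : eE m s / s * (zz m e - rR m s * yy m e) = eE m s / s * zz m e - nN m s * yy m e := by
      unfold rR; field_simp
    rw [hr, hu2, ← hss]
    unfold eE nN
    field_simp
    ring
  rw [heq] at hpos
  exact ⟨by linarith, by positivity⟩
end

section
/- For every integer m ≥ 2, the derivative B_m' has at least one zero in the interval 0 < e < 1. -/
open Real Set

open Filter Topology MeasureTheory

noncomputable def auxF (n k : ℕ) (φ x : ℝ) : ℝ :=
  ∫ t in (0:ℝ)..(2 * π), Real.sin t ^ k * Real.cos (n * t - x * Real.sin t + φ)

lemma auxF_hasDerivAt (n k : ℕ) (φ x : ℝ) :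
    HasDerivAt (auxF n k φ) (auxF n (k+1) (φ - π/2) x) x := by
  unfold auxF
  refine (intervalIntegral.hasDerivAt_integral_of_dominated_loc_of_deriv_le
    (F := fun x t => Real.sin t ^ k * Real.cos (n * t - x * Real.sin t + φ))
    (F' := fun x t => Real.sin t ^ (k+1) * Real.cos (n * t - x * Real.sin t + (φ - π/2)))
    (bound := fun _ => 1) (s := univ) univ_mem ?_ ?_ ?_ ?_ ?_ ?_).2
  · exact Eventually.of_forall fun x => Continuous.aestronglyMeasurable (by fun_prop)
  · exact Continuous.intervalIntegrable (by fun_prop) _ _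
  · exact Continuous.aestronglyMeasurable (by fun_prop)
  · refine Eventually.of_forall fun t _ x _ => ?_
    rw [norm_mul, norm_pow]
    exact mul_le_one₀ (pow_le_one₀ (norm_nonneg _) (Real.abs_sin_le_one t)) (norm_nonneg _)
      (Real.abs_cos_le_one _)
  · exact intervalIntegrable_const
  · refine Eventually.of_forall fun t _ x _ => ?_
    have h1 : HasDerivAt (fun x : ℝ => n * t - x * Real.sin t + φ) (-Real.sin t) x := by
      have := (((hasDerivAt_id x).mul_const (Real.sin t)).const_sub (n * t)).add_const φ
      simpa using this
    have h2 := h1.cos.const_mul (Real.sin t ^ k)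
    refine h2.congr_deriv ?_
    rw [show (n * t - x * Real.sin t + (φ - π/2) : ℝ) = (n * t - x * Real.sin t + φ) - π/2 by ring,
      Real.cos_sub_pi_div_two]
    ring

lemma int_cos (k : ℝ) (j : ℤ) (hj : k = j) (hk : k ≠ 0) :
    ∫ t in (0:ℝ)..(2 * π), Real.cos (k * t) = 0 := by
  rw [intervalIntegral.integral_comp_mul_left (fun t => Real.cos t) hk]
  simp only [integral_cos, mul_zero, Real.sin_zero, sub_zero, smul_eq_mul]
  have : Real.sin (k * (2 * π)) = 0 := by
    rw [show k * (2 * π) = ((2 * j : ℤ) : ℝ) * π by push_cast; rw [hj]; ring]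
    exact Real.sin_int_mul_pi _
  rw [this, mul_zero]

lemma aux0 (n : ℕ) (hn : 2 ≤ n) : auxF n 0 0 0 = 0 := by
  unfold auxF
  simp only [pow_zero, one_mul, zero_mul, sub_zero, add_zero]
  exact int_cos n n (by simp) (by positivity)

lemma aux1 (n : ℕ) (hn : 2 ≤ n) : auxF n 1 (0 - π/2) 0 = 0 := by
  have h2 : (2:ℝ) ≤ n := by exact_mod_cast hn
  unfold auxF
  have : ∀ t : ℝ, Real.sin t ^ 1 * Real.cos (n * t - 0 * Real.sin t + (0 - π/2))
      = (1/2) * Real.cos ((n-1 : ℝ) * t) - (1/2) * Real.cos ((n+1 : ℝ) * t) := by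
    intro t
    rw [show (n * t - 0 * Real.sin t + (0 - π/2) : ℝ) = n * t - π/2 by ring,
      Real.cos_sub_pi_div_two, show (n-1 : ℝ) * t = n * t - t by ring,
      show (n+1 : ℝ) * t = n * t + t by ring, Real.cos_sub, Real.cos_add]
    ring
  simp only [this]
  rw [intervalIntegral.integral_sub (Continuous.intervalIntegrable (by fun_prop) _ _)
    (Continuous.intervalIntegrable (by fun_prop) _ _), intervalIntegral.integral_const_mul,
    intervalIntegral.integral_const_mul, int_cos (n-1) (n-1) (by simp) (by linarith),
    int_cos (n+1) (n+1) (by simp) (by linarith)]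
  simp

lemma aux2 (n : ℕ) (hn : 2 ≤ n) : auxF n 2 (0 - π/2 - π/2) 0 = if n = 2 then π/2 else 0 := by
  have h2 : (2:ℝ) ≤ n := by exact_mod_cast hn
  unfold auxF
  have : ∀ t : ℝ, Real.sin t ^ 2 * Real.cos (n * t - 0 * Real.sin t + (0 - π/2 - π/2))
      = (1/4) * Real.cos ((n-2 : ℝ) * t) + ((1/4) * Real.cos ((n+2 : ℝ) * t)
        - (1/2) * Real.cos (n * t)) := by
    intro t
    rw [show (n * t - 0 * Real.sin t + (0 - π/2 - π/2) : ℝ) = n * t - π by ring,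
      Real.cos_sub_pi, show (n-2 : ℝ) * t = n * t - 2 * t by ring,
      show (n+2 : ℝ) * t = n * t + 2 * t by ring, Real.cos_sub, Real.cos_add, Real.cos_two_mul,
      Real.cos_sq']
    ring
  simp only [this]
  rw [intervalIntegral.integral_add (Continuous.intervalIntegrable (by fun_prop) _ _)
    (Continuous.intervalIntegrable (by fun_prop) _ _),
    intervalIntegral.integral_sub (Continuous.intervalIntegrable (by fun_prop) _ _)
    (Continuous.intervalIntegrable (by fun_prop) _ _), intervalIntegral.integral_const_mul,
    intervalIntegral.integral_const_mul, intervalIntegral.integral_const_mul,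
    int_cos (n+2) (n+2) (by simp) (by linarith), int_cos n n (by simp) (by linarith)]
  split_ifs with h
  · subst h
    simp
    ring
  · rw [int_cos (n-2) (n-2) (by simp)]
    · simp
    · intro h'
      apply h
      have : (n:ℝ) = 2 := by linarith
      exact_mod_cast this

lemma besselJ_eq (n : ℕ) : besselJ n = fun x => (1 / (2 * π)) * auxF n 0 0 x := by
  funext x
  simp [besselJ, auxF]

lemma besselJ_hasDerivAt (n : ℕ) (x : ℝ) :
    HasDerivAt (besselJ n) ((1 / (2 * π)) * auxF n 1 (0 - π/2) x) x := by
  rw [besselJ_eq]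
  exact (auxF_hasDerivAt n 0 0 x).const_mul _

lemma besselJd_eq (n : ℕ) : besselJd n = fun x => (1 / (2 * π)) * auxF n 1 (0 - π/2) x := by
  funext x
  exact (besselJ_hasDerivAt n x).deriv

lemma besselJd_hasDerivAt (n : ℕ) (x : ℝ) :
    HasDerivAt (besselJd n) ((1 / (2 * π)) * auxF n 2 (0 - π/2 - π/2) x) x := by
  rw [besselJd_eq]
  exact (auxF_hasDerivAt n 1 _ x).const_mul _

lemma besselJ_cont (n : ℕ) : Continuous (besselJ n) :=
  continuous_iff_continuousAt.2 fun x => (besselJ_hasDerivAt n x).continuousAt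

lemma besselJd_cont (n : ℕ) : Continuous (besselJd n) :=
  continuous_iff_continuousAt.2 fun x => (besselJd_hasDerivAt n x).continuousAt

lemma lim0 (m : ℕ) (hm : 2 ≤ m) :
    Tendsto (coefB m) (𝓝[>] 0) (𝓝 (if m = 2 then 1 else 0)) := by
  have hm0 : (0:ℝ) < m := by positivity
  set c : ℝ := (1 / (2 * π)) * auxF m 2 (0 - π/2 - π/2) 0 with hc
  have hJ0 : besselJ m 0 = 0 := by rw [besselJ_eq]; simp [aux0 m hm]
  have hJd0 : besselJd m 0 = 0 := by
    have := aux1 m hm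
    rw [besselJd_eq]; simp only [this, mul_zero]
  have hd : Tendsto (fun x => besselJd m x / x) (𝓝[≠] 0) (𝓝 c) := by
    have := (besselJd_hasDerivAt m 0).tendsto_slope
    refine this.congr fun x => ?_
    simp [slope_def_field, hJd0]
  have hj : Tendsto (fun x => besselJ m x / x^2) (𝓝[≠] 0) (𝓝 (c/2)) := by
    refine HasDerivAt.lhopital_zero_nhdsNE (f' := besselJd m) (g' := fun x => 2 * x)
      ?_ ?_ ?_ ?_ ?_ ?_
    · refine Eventually.of_forall fun x => ?_
      rw [besselJd_eq]; exact besselJ_hasDerivAt m x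
    · refine Eventually.of_forall fun x => ?_
      simpa using hasDerivAt_pow 2 x
    · filter_upwards [self_mem_nhdsWithin] with x hx
      have : x ≠ 0 := hx
      positivity
    · have := (besselJ_cont m).tendsto 0
      rw [hJ0] at this
      exact this.mono_left nhdsWithin_le_nhds
    · have : Tendsto (fun x : ℝ => x^2) (𝓝 0) (𝓝 0) := by
        simpa using (continuous_pow 2).tendsto (0:ℝ)
      exact this.mono_left nhdsWithin_le_nhds
    · refine (hd.div_const 2).congr fun x => ?_
      rw [div_div, mul_comm]
  have hme : Tendsto (fun e : ℝ => m * e) (𝓝[>] 0) (𝓝[≠] 0) := by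
    refine tendsto_nhdsWithin_iff.2 ⟨?_, ?_⟩
    · have : Tendsto (fun e : ℝ => m * e) (𝓝 0) (𝓝 0) := by
        simpa using (continuous_const_mul (m:ℝ)).tendsto (0:ℝ)
      exact this.mono_left nhdsWithin_le_nhds
    · filter_upwards [self_mem_nhdsWithin] with x hx
      have : 0 < x := hx
      have : (m:ℝ) * x ≠ 0 := by positivity
      exact this
  have hd' := hd.comp hme
  have hj' := hj.comp hme
  have hs : Tendsto (fun e : ℝ => Real.sqrt (1 - e^2)) (𝓝[>] 0) (𝓝 1) := by
    have : Continuous (fun e : ℝ => Real.sqrt (1 - e^2)) := by fun_prop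
    have := this.tendsto 0
    simp at this
    exact this.mono_left nhdsWithin_le_nhds
  have hp : Tendsto (fun e : ℝ => 1 - e^2) (𝓝[>] 0) (𝓝 1) := by
    have : Continuous (fun e : ℝ => 1 - e^2) := by fun_prop
    have := this.tendsto 0
    simp at this
    exact this.mono_left nhdsWithin_le_nhds
  have key := (hs.const_mul (-(8 / (m:ℝ)^2))).mul
    ((hd'.const_mul (m:ℝ)).sub ((hp.const_mul ((m:ℝ)^3)).mul hj'))
  have hval : -(8 / (m:ℝ)^2) * 1 * (m * c - m^3 * 1 * (c/2)) = if m = 2 then 1 else 0 := by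
    rw [hc, aux2 m hm]
    split_ifs with h
    · subst h
      have := Real.pi_ne_zero
      push_cast
      field_simp
      norm_num
    · simp
  rw [hval] at key
  refine key.congr' ?_
  filter_upwards [self_mem_nhdsWithin] with e he
  have he : 0 < e := he
  simp only [Function.comp, coefB]
  field_simp

lemma coefB_contAt (m : ℕ) (hm : 2 ≤ m) (e : ℝ) (he : e ≠ 0) : ContinuousAt (coefB m) e := by
  have hm0 : (0:ℝ) < m := by positivity
  have h1 := besselJ_cont m
  have h2 := besselJd_cont m
  have h3 : (m:ℝ)^2 * e^2 ≠ 0 := by positivity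
  unfold coefB
  refine ContinuousAt.mul (ContinuousAt.mul (ContinuousAt.neg
    (ContinuousAt.div continuousAt_const (by fun_prop) h3)) (by fun_prop)) ?_
  exact Continuous.continuousAt (by fun_prop)

lemma coefB_one (m : ℕ) : coefB m 1 = 0 := by simp [coefB]

lemma lim1 (m : ℕ) (hm : 2 ≤ m) : Tendsto (coefB m) (𝓝[<] 1) (𝓝 0) := by
  have := (coefB_contAt m hm 1 one_ne_zero).tendsto
  rw [coefB_one] at this
  exact this.mono_left nhdsWithin_le_nhds

lemma cos_up {x : ℝ} (hx : 0 ≤ x) : Real.cos x ≤ 1 - x^2/2 + x^4/24 := by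
  have : MonotoneOn (fun x : ℝ => 1 - x^2/2 + x^4/24 - Real.cos x) (Ici 0) := by
    apply monotoneOn_of_deriv_nonneg (convex_Ici 0) (by fun_prop) (by fun_prop)
    intro y hy
    rw [interior_Ici] at hy
    have hd : HasDerivAt (fun x : ℝ => 1 - x^2/2 + x^4/24 - Real.cos x)
        (-(2*y/2) + 4*y^3/24 - -Real.sin y) y := by
      have h2 := (hasDerivAt_pow 2 y).div_const 2
      have h4 := (hasDerivAt_pow 4 y).div_const 24
      exact (((h2.const_sub 1).add h4).sub (Real.hasDerivAt_cos y)).congr_deriv (by simp)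
    rw [hd.deriv]
    have := Real.sin_ge_sub_cube (le_of_lt hy)
    linarith
  have := this (mem_Ici.2 le_rfl) (mem_Ici.2 hx) hx
  simp at this
  linarith

lemma sin_up {x : ℝ} (hx : 0 ≤ x) : Real.sin x ≤ x - x^3/6 + x^5/120 := by
  have : MonotoneOn (fun x : ℝ => x - x^3/6 + x^5/120 - Real.sin x) (Ici 0) := by
    apply monotoneOn_of_deriv_nonneg (convex_Ici 0) (by fun_prop) (by fun_prop)
    intro y hy
    rw [interior_Ici] at hy
    have hd : HasDerivAt (fun x : ℝ => x - x^3/6 + x^5/120 - Real.sin x)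
        (1 - (3*y^2/6) + 5*y^4/120 - Real.cos y) y := by
      have h2 := (hasDerivAt_pow 3 y).div_const 6
      have h4 := (hasDerivAt_pow 5 y).div_const 120
      exact ((((hasDerivAt_id y).sub h2).add h4).sub (Real.hasDerivAt_sin y)).congr_deriv (by simp)
    rw [hd.deriv]
    have := cos_up (le_of_lt hy)
    linarith
  have := this (mem_Ici.2 le_rfl) (mem_Ici.2 hx) hx
  simp at this
  linarith

lemma ptw_nonneg {s : ℝ} (hs : 0 ≤ s) :
    s * (2*s^2-1) * (2*s - 4/3*s^3) - 4/15*s^6 ≤ s * (2*s^2-1) * Real.sin (2*s) := by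
  have h1 := Real.sin_ge_sub_cube (x := 2*s) (by positivity)
  have h2 := sin_up (x := 2*s) (by positivity)
  set r := Real.sin (2*s) - (2*s - 4/3*s^3) with hr
  have hr0 : 0 ≤ r := by rw [hr]; linarith
  have hr1 : r ≤ 4/15*s^5 := by rw [hr]; linarith
  have h3 : s * r ≤ s * (4/15*s^5) := by gcongr
  have h4 : 0 ≤ s^3 * r := by positivity
  have : s * (2*s^2-1) * Real.sin (2*s)
      = s * (2*s^2-1) * (2*s - 4/3*s^3) + (2 * (s^3*r) - s * r) := by rw [hr]; ring
  rw [this]; linarith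

lemma ptw (s : ℝ) :
    s * (2*s^2-1) * (2*s - 4/3*s^3) - 4/15*s^6 ≤ s * (2*s^2-1) * Real.sin (2*s) := by
  rcases le_total 0 s with h | h
  · exact ptw_nonneg h
  · have := ptw_nonneg (s := -s) (by linarith)
    rw [show 2 * -s = -(2*s) by ring, Real.sin_neg] at this
    linarith

lemma int_zero : ∫ t in (0:ℝ)..(2 * π), 2 * Real.sin t^2 * Real.cos (2 * Real.sin t) * Real.cos t
    = 0 := by
  rw [intervalIntegral.integral_eq_sub_of_hasDerivAt (f := fun t =>
    Real.sin t^2 * Real.sin (2 * Real.sin t) + Real.sin t * Real.cos (2 * Real.sin t)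
      - Real.sin (2 * Real.sin t) / 2)]
  · simp
  · intro t _
    have h1 := Real.hasDerivAt_sin t
    have h2 := h1.const_mul 2
    have := (((h1.pow 2).mul h2.sin).add (h1.mul h2.cos)).sub (h2.sin.div_const 2)
    refine this.congr_deriv ?_
    simp
    ring
  · exact Continuous.intervalIntegrable (by fun_prop) _ _

lemma auxpos : 0 < auxF 2 1 (0 - π/2) 2 := by
  unfold auxF
  have hpt : ∀ t : ℝ, Real.sin t ^ 1 * Real.cos ((2:ℕ) * t - 2 * Real.sin t + (0 - π/2))
      = 2 * Real.sin t^2 * Real.cos (2 * Real.sin t) * Real.cos t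
        + Real.sin t * (2 * Real.sin t^2 - 1) * Real.sin (2 * Real.sin t) := by
    intro t
    rw [show ((2:ℕ) * t - 2 * Real.sin t + (0 - π/2) : ℝ) = (2 * t - 2 * Real.sin t) - π/2 by
      push_cast; ring, Real.cos_sub_pi_div_two, Real.sin_sub, Real.sin_two_mul t, Real.cos_two_mul t,
      Real.cos_sq' t]
    ring
  simp only [hpt]
  rw [intervalIntegral.integral_add (Continuous.intervalIntegrable (by fun_prop) _ _)
    (Continuous.intervalIntegrable (by fun_prop) _ _), int_zero, zero_add]
  have hle : ∫ t in (0:ℝ)..(2*π), ((16/3) * Real.sin t^4 - 2 * Real.sin t^2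
        - (44/15) * Real.sin t^6)
      ≤ ∫ t in (0:ℝ)..(2*π), Real.sin t * (2 * Real.sin t^2 - 1) * Real.sin (2 * Real.sin t) := by
    apply intervalIntegral.integral_mono (by positivity)
      (Continuous.intervalIntegrable (by fun_prop) _ _)
      (Continuous.intervalIntegrable (by fun_prop) _ _)
    intro t
    have := ptw (Real.sin t)
    simp only
    linarith
  refine lt_of_lt_of_le ?_ hle
  rw [intervalIntegral.integral_sub (Continuous.intervalIntegrable (by fun_prop) _ _)
    (Continuous.intervalIntegrable (by fun_prop) _ _),
    intervalIntegral.integral_sub (Continuous.intervalIntegrable (by fun_prop) _ _)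
    (Continuous.intervalIntegrable (by fun_prop) _ _), intervalIntegral.integral_const_mul,
    intervalIntegral.integral_const_mul, intervalIntegral.integral_const_mul]
  have i2 : ∫ t in (0:ℝ)..(2*π), Real.sin t^2 = π := by simp
  have i4 : ∫ t in (0:ℝ)..(2*π), Real.sin t^4 = 3/4*π := by
    rw [integral_sin_pow (n := 2), i2]; simp; ring
  have i6 : ∫ t in (0:ℝ)..(2*π), Real.sin t^6 = 5/8*π := by
    rw [integral_sin_pow (n := 4), i4]; simp; ring
  rw [i2, i4, i6]
  have := Real.pi_pos
  linarith

lemma neg_near : ∀ᶠ e in 𝓝[<] (1:ℝ), coefB 2 e < 0 := by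
  have hc : Continuous fun e : ℝ => e * besselJd (2:ℕ) ((2:ℕ) * e)
      - (2:ℕ) * (1 - e ^ 2) * besselJ (2:ℕ) ((2:ℕ) * e) := by
    have h1 := besselJ_cont 2
    have h2 := besselJd_cont 2
    fun_prop
  have h1 : 0 < (1:ℝ) * besselJd (2:ℕ) ((2:ℕ) * 1)
      - (2:ℕ) * (1 - 1 ^ 2) * besselJ (2:ℕ) ((2:ℕ) * 1) := by
    have := auxpos
    have hp := Real.pi_pos
    rw [besselJd_eq]
    simp only [Nat.cast_ofNat, mul_one, one_mul, one_pow, sub_self, mul_zero, zero_mul, sub_zero]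
    positivity
  have h2 := (hc.tendsto 1).eventually (lt_mem_nhds h1)
  filter_upwards [h2.filter_mono nhdsWithin_le_nhds, Ioo_mem_nhdsLT (zero_lt_one (α := ℝ))]
    with e he he'
  unfold coefB
  have h3 : 0 < Real.sqrt (1 - e^2) := Real.sqrt_pos.2 (by nlinarith [he'.1, he'.2])
  have h4 : 0 < 8 / (((2:ℕ):ℝ)^2 * e^2) := by have := he'.1; positivity
  have := mul_pos (mul_pos h4 h3) he
  linarith

/-- For every integer `m ≥ 2`, the derivative `B_m'` has at least one zero in `(0,1)`. -/
theorem stmt_11 (m : ℕ) (hm : 2 ≤ m) :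
    ∃ e ∈ Set.Ioo (0:ℝ) 1, deriv (coefB m) e = 0 := by
  have l0 := lim0 m hm
  have l1 := lim1 m hm
  by_cases h : m = 2
  · subst h
    simp only [if_true] at l0
    obtain ⟨a, ha, ha'⟩ := ((l0.eventually (lt_mem_nhds (zero_lt_one (α := ℝ)))).and
      (Ioo_mem_nhdsGT (zero_lt_one (α := ℝ)))).exists
    obtain ⟨b, hb, hb'⟩ := (neg_near.and (Ioo_mem_nhdsLT ha'.2)).exists
    obtain ⟨z, hz, hz0⟩ := intermediate_value_Icc' hb'.1.le
      (fun x hx => (coefB_contAt 2 hm x (by linarith [ha'.1, hx.1])).continuousWithinAt)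
      ⟨hb.le, ha.le⟩
    have hz_pos : 0 < z := lt_of_lt_of_le ha'.1 hz.1
    have hz1 : z < 1 := lt_of_le_of_lt hz.2 hb'.2
    have lz := (coefB_contAt 2 hm z hz_pos.ne').tendsto
    rw [hz0] at lz
    obtain ⟨c, hc, hc'⟩ := exists_deriv_eq_zero' hz1 (lz.mono_left nhdsWithin_le_nhds) l1
    exact ⟨c, ⟨hz_pos.trans hc.1, hc.2⟩, hc'⟩
  · rw [if_neg h] at l0
    exact exists_deriv_eq_zero' zero_lt_one l0 l1
end

section
/- For every integer m ≥ 2, the limit of A_m'(e)/B_m'(e) as e → 0⁺ equals 1; indeed both A_m'(e) and B_m'(e) have the common leading Taylor behavior −5e + O(e²) when m = 2 and (8m^m(m−1)(m−2)/(2^m m! m²))e^{m−3} + O(e^{m−2}) when m > 2. -/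
open Real Set

open Filter Asymptotics

lemma bj_deriv (n : ℤ) (x : ℝ) :
    HasDerivAt (besselJ n) ((besselJ (n-1) x - besselJ (n+1) x) / 2) x := by
  have h := (intervalIntegral.hasDerivAt_integral_of_dominated_loc_of_deriv_le
    (μ := MeasureTheory.volume) (a := 0) (b := 2 * π) (x₀ := x) (s := Set.univ) (bound := fun _ => (1:ℝ))
    (F := fun x t => Real.cos (n * t - x * Real.sin t))
    (F' := fun x t => Real.sin t * Real.sin (n * t - x * Real.sin t))
    Filter.univ_mem
    (Filter.Eventually.of_forall fun y => by
      apply Continuous.aestronglyMeasurable; fun_prop)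
    (by apply Continuous.intervalIntegrable; fun_prop)
    (by apply Continuous.aestronglyMeasurable; fun_prop)
    (Filter.Eventually.of_forall fun t _ y _ => by
      rw [norm_mul]
      have h1 := Real.abs_sin_le_one t
      have h2 := Real.abs_sin_le_one (n * t - y * Real.sin t)
      simp only [Real.norm_eq_abs]
      nlinarith [abs_nonneg (Real.sin t), abs_nonneg (Real.sin (n * t - y * Real.sin t))])
    (by simp)
    (Filter.Eventually.of_forall fun t _ y _ => by
      have h1 : HasDerivAt (fun y : ℝ => (n:ℝ) * t - y * Real.sin t) (-(1 * Real.sin t)) y :=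
        ((hasDerivAt_id y).mul_const _).const_sub _
      refine h1.cos.congr_deriv ?_
      ring)).2
  have h2 := h.const_mul (1 / (2 * π))
  unfold besselJ
  refine h2.congr_deriv ?_
  symm
  rw [← mul_sub, ← intervalIntegral.integral_sub, mul_div_assoc]
  · congr 1
    rw [← intervalIntegral.integral_div]
    congr 1
    ext t
    have e1 : ((n - 1 : ℤ) : ℝ) * t - x * Real.sin t = (n * t - x * Real.sin t) - t := by
      push_cast; ring
    have e2 : ((n + 1 : ℤ) : ℝ) * t - x * Real.sin t = (n * t - x * Real.sin t) + t := by
      push_cast; ring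
    rw [e1, e2]
    generalize (n:ℝ) * t - x * Real.sin t = u
    rw [Real.cos_sub, Real.cos_add]
    ring
  · apply Continuous.intervalIntegrable; fun_prop
  · apply Continuous.intervalIntegrable; fun_prop

lemma bj_rec (n : ℤ) (x : ℝ) :
    2 * n * besselJ n x = x * (besselJ (n-1) x + besselJ (n+1) x) := by
  have h : ∫ t in (0:ℝ)..(2 * π), Real.cos (n * t - x * Real.sin t) * (n - x * Real.cos t) = 0 := by
    rw [intervalIntegral.integral_eq_sub_of_hasDerivAt
      (f := fun t => Real.sin (n * t - x * Real.sin t))]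
    · simp
      have := Real.sin_int_mul_pi (2 * n)
      push_cast at this
      rw [← this]; congr 1; ring
    · intro t _
      have h1 : HasDerivAt (fun t : ℝ => (n:ℝ) * t - x * Real.sin t) (n * 1 - x * Real.cos t) t :=
        ((hasDerivAt_id t).const_mul _).sub ((Real.hasDerivAt_sin t).const_mul _)
      simpa using h1.sin
    · apply Continuous.intervalIntegrable; fun_prop
  have h3 : 2 * (n:ℝ) * (∫ t in (0:ℝ)..(2 * π), Real.cos (n * t - x * Real.sin t))
      - x * ((∫ t in (0:ℝ)..(2 * π), Real.cos ((n-1 : ℤ) * t - x * Real.sin t)) +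
        ∫ t in (0:ℝ)..(2 * π), Real.cos ((n+1 : ℤ) * t - x * Real.sin t)) = 0 := by
    have h2 := congrArg (fun y => 2 * y) h
    simp only [mul_zero] at h2
    refine Eq.trans ?_ h2
    rw [← intervalIntegral.integral_add, ← intervalIntegral.integral_const_mul,
      ← intervalIntegral.integral_const_mul, ← intervalIntegral.integral_const_mul,
      ← intervalIntegral.integral_sub]
    · apply intervalIntegral.integral_congr_ae
      apply Filter.Eventually.of_forall
      intro t _
      have e1 : ((n - 1 : ℤ) : ℝ) * t - x * Real.sin t = (n * t - x * Real.sin t) - t := by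
        push_cast; ring
      have e2 : ((n + 1 : ℤ) : ℝ) * t - x * Real.sin t = (n * t - x * Real.sin t) + t := by
        push_cast; ring
      rw [e1, e2]
      generalize (n:ℝ) * t - x * Real.sin t = u
      rw [Real.cos_sub, Real.cos_add]
      ring
    all_goals (apply Continuous.intervalIntegrable; fun_prop)
  unfold besselJ
  linear_combination (1 / (2 * π)) * h3

lemma bj_le_one (n : ℤ) (x : ℝ) : |besselJ n x| ≤ 1 := by
  have h := intervalIntegral.norm_integral_le_of_norm_le_const (a := 0) (b := 2 * π) (C := 1)
    (f := fun t => Real.cos (n * t - x * Real.sin t))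
    (fun t _ => by simpa using Real.abs_cos_le_one _)
  have hp := Real.pi_pos
  unfold besselJ
  rw [abs_mul, abs_of_pos (by positivity : 0 < 1 / (2 * π))]
  rw [Real.norm_eq_abs, sub_zero, abs_of_pos (by positivity : 0 < 2 * π)] at h
  rw [div_mul_eq_mul_div, div_le_one (by positivity)]
  simpa using h

lemma bj_zero_s13 (x : ℝ) : |besselJ 0 x - 1| ≤ x ^ 2 := by
  have h := intervalIntegral.norm_integral_le_of_norm_le_const (a := 0) (b := 2 * π) (C := x ^ 2)
    (f := fun t => Real.cos ((0 : ℤ) * t - x * Real.sin t) - 1)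
    (fun t _ => by
      rw [Real.norm_eq_abs, abs_sub_comm, abs_of_nonneg (by linarith [Real.cos_le_one (((0:ℤ):ℝ) * t - x * Real.sin t)])]
      have h1 := Real.one_sub_sq_div_two_le_cos (x := ((0:ℤ):ℝ) * t - x * Real.sin t)
      have h2 : (((0:ℤ):ℝ) * t - x * Real.sin t) ^ 2 ≤ x ^ 2 := by
        have : (((0:ℤ):ℝ) * t - x * Real.sin t) ^ 2 = x ^ 2 * Real.sin t ^ 2 := by push_cast; ring
        rw [this]
        nlinarith [Real.sin_sq_le_one t, sq_nonneg x]
      generalize Real.cos (((0:ℤ):ℝ) * t - x * Real.sin t) = c at *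
      generalize (((0:ℤ):ℝ) * t - x * Real.sin t) ^ 2 = y at *
      have h3 := sq_nonneg x
      linarith)
  have hp := Real.pi_pos
  have e : besselJ 0 x - 1 = (1 / (2 * π)) *
      ∫ t in (0:ℝ)..(2 * π), (Real.cos ((0 : ℤ) * t - x * Real.sin t) - 1) := by
    rw [intervalIntegral.integral_sub]
    · unfold besselJ
      simp
      field_simp
    all_goals (apply Continuous.intervalIntegrable; fun_prop)
  rw [e, abs_mul, abs_of_pos (by positivity : 0 < 1 / (2 * π))]
  rw [Real.norm_eq_abs, sub_zero, abs_of_pos (by positivity : 0 < 2 * π)] at h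
  rw [div_mul_eq_mul_div, div_le_iff₀ (by positivity)]
  simpa using h

lemma bj_bd (k : ℕ) : ∀ n : ℤ, (k:ℤ) ≤ n → ∀ x : ℝ, 0 < x → |besselJ n x| ≤ x ^ k := by
  induction k with
  | zero => intro n _ x _; simpa using bj_le_one n x
  | succ k ih =>
    intro n hn x hx
    push_cast at hn
    have h1 := ih (n-1) (by omega) x hx
    have h2 := ih (n+1) (by omega) x hx
    have hr := bj_rec n x
    have hn1 : (1:ℝ) ≤ n := by exact_mod_cast (by omega : (1:ℤ) ≤ n)
    have h3 : |2 * n * besselJ n x| ≤ x * (x ^ k + x ^ k) := by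
      rw [hr, abs_mul, abs_of_pos hx]
      gcongr
      exact (abs_add_le _ _).trans (add_le_add h1 h2)
    rw [abs_mul, abs_of_pos (by linarith : (0:ℝ) < 2 * n)] at h3
    have : 2 * 1 * |besselJ n x| ≤ 2 * n * |besselJ n x| := by gcongr
    rw [pow_succ]
    linarith

lemma bj_asym (n : ℕ) : ∀ x : ℝ, 0 < x →
    |besselJ n x - x ^ n / (2 ^ n * n.factorial)| ≤ x ^ (n + 2) := by
  induction n with
  | zero => intro x _; simpa using bj_zero_s13 x
  | succ n ih =>
    intro x hx
    have h1 := ih x hx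
    have h2 := bj_bd (n+2) (n+1+1) (by push_cast; omega) x hx
    have hr := bj_rec ((n:ℤ)+1) x
    rw [add_sub_cancel_right] at hr
    push_cast at hr ⊢
    set j := besselJ ((n:ℤ)+1) x
    have hn0 : (0:ℝ) ≤ n := Nat.cast_nonneg n
    have e : 2 * ((n:ℝ) + 1) * (j - x ^ (n+1) / (2 ^ (n+1) * (n+1).factorial)) =
      x * ((besselJ n x - x ^ n / (2 ^ n * n.factorial)) + besselJ (n+1+1) x) := by
      rw [mul_sub, hr, Nat.factorial_succ]
      push_cast
      have : (n.factorial : ℝ) ≠ 0 := by positivity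
      field_simp
      ring
    have h3 : |2 * ((n:ℝ) + 1) * (j - x ^ (n+1) / (2 ^ (n+1) * (n+1).factorial))| ≤
        x * (x ^ (n+2) + x ^ (n+2)) := by
      rw [e, abs_mul, abs_of_pos hx]
      gcongr
      exact (abs_add_le _ _).trans (add_le_add h1 h2)
    rw [abs_mul, abs_of_pos (by linarith : (0:ℝ) < 2 * ((n:ℝ)+1))] at h3
    have : 2 * 1 * |j - x ^ (n+1) / (2 ^ (n+1) * (n+1).factorial)| ≤
       2 * ((n:ℝ)+1) * |j - x ^ (n+1) / (2 ^ (n+1) * (n+1).factorial)| := by gcongr; linarith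
    have e3 : x ^ (n + 1 + 2) = x * x ^ (n+2) := by ring
    rw [e3]
    linarith

lemma bjd_eq (n : ℤ) (x : ℝ) (hx : x ≠ 0) :
    besselJd n x = n / x * besselJ n x - besselJ (n+1) x := by
  unfold besselJd
  rw [(bj_deriv n x).deriv]
  have := bj_rec n x
  field_simp
  linarith

lemma bj_deriv1 (m : ℕ) (hm : 2 ≤ m) (e : ℝ) (he : e ≠ 0) :
    HasDerivAt (fun e : ℝ => besselJ m (m * e))
      (m * (besselJ m (m * e) / e - besselJ (m+1) (m * e))) e := by
  have hm0 : (m:ℝ) ≠ 0 := by positivity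
  have h := (bj_deriv m (m * e)).comp e ((hasDerivAt_id e).const_mul (m:ℝ))
  refine h.congr_deriv ?_
  have := bj_rec m (m * e)
  field_simp
  push_cast at this
  have h2 : 2 * besselJ m (m * e) = e * (besselJ (m-1) (m*e) + besselJ (m+1) (m*e)) := by
    apply mul_left_cancel₀ hm0
    linarith
  linarith

lemma bj_deriv2 (m : ℕ) (hm : 2 ≤ m) (e : ℝ) (he : e ≠ 0) :
    HasDerivAt (fun e : ℝ => besselJ (m+1) (m * e))
      (m * besselJ m (m * e) - (m+1) * besselJ (m+1) (m * e) / e) e := by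
  have hm0 : (m:ℝ) ≠ 0 := by positivity
  have h := (bj_deriv (m+1) (m * e)).comp e ((hasDerivAt_id e).const_mul (m:ℝ))
  refine h.congr_deriv ?_
  have := bj_rec (m+1) (m * e)
  simp only [mul_one, add_sub_cancel_right] at this ⊢
  push_cast at this
  field_simp
  linarith

lemma derivA (m : ℕ) (hm : 2 ≤ m) (e : ℝ) (he : 0 < e) :
    deriv (coefA m) e = 4 / ((m:ℝ)^2 * e ^ 3) *
      (besselJ m (m*e) * (2 * (m-1) * (m-2) - e^2 * (4 * m^2 - m) + 2 * m^2 * e^4)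
        + e * besselJ (m+1) (m*e) * (6 * m - m * e^2)) := by
  have hm0 : (m:ℝ) ≠ 0 := by positivity
  have he0 := he.ne'
  have hev : coefA m =ᶠ[nhds e] fun e => 4 / (m:ℝ)^2 * (((2 * m - 2 - (2 * m - 1) * e^2) * besselJ m (m*e)
      - (2 * m * e * (1 - e^2)) * besselJ (m+1) (m*e)) / e^2) := by
    filter_upwards [lt_mem_nhds he] with y hy
    have hy0 := hy.ne'
    unfold coefA
    rw [bjd_eq _ _ (by positivity)]
    push_cast
    field_simp
    ring
  rw [hev.deriv_eq]
  have p1 : HasDerivAt (fun e : ℝ => 2 * (m:ℝ) - 2 - (2 * m - 1) * e^2) (-((2 * m - 1) * (2 * e))) e := by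
    have := ((hasDerivAt_pow 2 e).const_mul (2 * (m:ℝ) - 1)).const_sub (2 * (m:ℝ) - 2)
    simpa using this
  have p2 : HasDerivAt (fun e : ℝ => 2 * (m:ℝ) * e * (1 - e^2)) (2 * m * (1 - 3 * e^2)) e := by
    have := ((hasDerivAt_id e).const_mul (2 * (m:ℝ))).mul ((hasDerivAt_pow 2 e).const_sub 1)
    refine this.congr_deriv ?_
    simp; ring
  have h := ((((p1.mul (bj_deriv1 m hm e he0)).sub (p2.mul (bj_deriv2 m hm e he0))).div
    (hasDerivAt_pow 2 e) (by positivity)).const_mul (4 / (m:ℝ)^2))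
  refine h.deriv.trans ?_
  simp only [Pi.mul_apply, Pi.sub_apply]
  field_simp
  push_cast
  ring

lemma derivB (m : ℕ) (hm : 2 ≤ m) (e : ℝ) (he : 0 < e) (he1 : e < 1) :
    deriv (coefB m) e = (1 / Real.sqrt (1 - e^2)) * (8 / ((m:ℝ)^2 * e ^ 3) *
      (besselJ m (m*e) * ((m-1) * (m-2) - e^2 * (2 * m^2 - 3 * m + 1) + m^2 * e^4)
        - e * besselJ (m+1) (m*e) * (m^2 + 2 - e^2 * (2 * m^2 + 1) + m^2 * e^4))) := by
  have hm0 : (m:ℝ) ≠ 0 := by positivity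
  have he0 := he.ne'
  have hev : coefB m =ᶠ[nhds e] fun e => -8 / (m:ℝ)^2 * (Real.sqrt (1 - e^2) * ((1 - m + m * e^2) * besselJ m (m*e)
      - e * besselJ (m+1) (m*e)) / e^2) := by
    filter_upwards [lt_mem_nhds he] with y hy
    have hy0 := hy.ne'
    unfold coefB
    rw [bjd_eq _ _ (by positivity)]
    push_cast
    field_simp
    ring
  rw [hev.deriv_eq]
  have hpos : 0 < 1 - e^2 := by nlinarith
  have p1 : HasDerivAt (fun e : ℝ => 1 - (m:ℝ) + m * e^2) (m * (2 * e)) e := by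
    have := ((hasDerivAt_pow 2 e).const_mul (m:ℝ)).const_add (1 - (m:ℝ))
    simpa using this
  have ps : HasDerivAt (fun e : ℝ => Real.sqrt (1 - e^2)) (-e / Real.sqrt (1 - e^2)) e := by
    have := ((hasDerivAt_pow 2 e).const_sub 1).sqrt hpos.ne'
    refine this.congr_deriv ?_
    have : Real.sqrt (1 - e^2) ≠ 0 := by positivity
    field_simp
    push_cast
    ring
  have h := (((ps.mul ((p1.mul (bj_deriv1 m hm e he0)).sub ((hasDerivAt_id e).mul (bj_deriv2 m hm e he0)))).div
    (hasDerivAt_pow 2 e) (by positivity)).const_mul (-8 / (m:ℝ)^2))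
  refine h.deriv.trans ?_
  have hs : Real.sqrt (1 - e^2) ^ 2 = 1 - e^2 := Real.sq_sqrt hpos.le
  have hs0 : Real.sqrt (1 - e^2) ≠ 0 := by positivity
  simp only [Pi.mul_apply, Pi.sub_apply, id]
  generalize Real.sqrt (1 - e^2) = s at *
  field_simp
  rw [hs]
  push_cast
  ring

def Bd (f : ℝ → ℝ) : Prop := f =O[nhdsWithin 0 (Set.Ioi 0)] (fun _ => (1:ℝ))

lemma Bd.add' {f g : ℝ → ℝ} (hf : Bd f) (hg : Bd g) : Bd (fun e => f e + g e) := IsBigO.add hf hg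
lemma Bd.sub' {f g : ℝ → ℝ} (hf : Bd f) (hg : Bd g) : Bd (fun e => f e - g e) := IsBigO.sub hf hg
lemma Bd.mul' {f g : ℝ → ℝ} (hf : Bd f) (hg : Bd g) : Bd (fun e => f e * g e) := by
  simpa [Bd] using IsBigO.mul hf hg
lemma Bd.neg' {f : ℝ → ℝ} (hf : Bd f) : Bd (fun e => - f e) := IsBigO.neg_left hf
lemma Bd.const (c : ℝ) : Bd (fun _ => c) := isBigO_const_const c one_ne_zero _
lemma Bd.id' : Bd (fun e => e) := by
  have : Tendsto (fun e : ℝ => e) (nhdsWithin 0 (Set.Ioi 0)) (nhds 0) := nhdsWithin_le_nhds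
  exact this.isBigO_one ℝ
lemma Bd.pow' (k : ℕ) : Bd (fun e => e ^ k) := by
  simpa [Bd] using IsBigO.pow Bd.id' k

lemma Bd.of_le (f : ℝ → ℝ) (C : ℝ) (h : ∀ e, 0 < e → e < 1/2 → |f e| ≤ C) : Bd f := by
  apply IsBigO.of_bound C
  have : Set.Ioo (0:ℝ) (1/2) ∈ nhdsWithin (0:ℝ) (Set.Ioi 0) := Ioo_mem_nhdsGT (by norm_num)
  filter_upwards [this] with e he
  simpa using h e he.1 he.2

lemma fin_asym (f R : ℝ → ℝ) (L : ℝ) (n : ℕ) (hR : Bd R)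
    (h : ∀ e, 0 < e → e < 1/2 → f e = L * e ^ n + e ^ (n+1) * R e) :
    (fun e => f e - L * e ^ n) =O[nhdsWithin 0 (Set.Ioi 0)] fun e => e ^ (n+1) := by
  have h1 : (fun e => e ^ (n+1) * R e) =O[nhdsWithin 0 (Set.Ioi 0)] fun e => e ^ (n+1) := by
    simpa using (isBigO_refl (fun e : ℝ => e ^ (n+1)) _).mul hR
  refine h1.congr' ?_ EventuallyEq.rfl
  have : Set.Ioo (0:ℝ) (1/2) ∈ nhdsWithin (0:ℝ) (Set.Ioi 0) := Ioo_mem_nhdsGT (by norm_num)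
  filter_upwards [this] with e he
  rw [h e he.1 he.2]; ring

lemma lim_of (f : ℝ → ℝ) (L : ℝ) (n : ℕ)
    (h : (fun e => f e - L * e ^ n) =O[nhdsWithin 0 (Set.Ioi 0)] fun e => e ^ (n+1)) :
    Tendsto (fun e => f e / e ^ n) (nhdsWithin 0 (Set.Ioi 0)) (nhds L) := by
  have h1 := h.mul (isBigO_refl (fun e : ℝ => (e ^ n)⁻¹) (nhdsWithin 0 (Set.Ioi 0)))
  have ht : Tendsto (fun e : ℝ => e) (nhdsWithin 0 (Set.Ioi 0)) (nhds 0) := nhdsWithin_le_nhds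
  have hpos : ∀ᶠ e : ℝ in nhdsWithin 0 (Set.Ioi 0), 0 < e := self_mem_nhdsWithin
  have h2 : (fun e => f e / e ^ n - L) =O[nhdsWithin 0 (Set.Ioi 0)] fun e => e := by
    refine h1.congr' ?_ ?_
    · filter_upwards [hpos] with e he
      field_simp
    · filter_upwards [hpos] with e he
      field_simp
      ring
  have h3 := h2.trans_tendsto ht
  simpa using h3.add_const L

lemma ratio_of (f g : ℝ → ℝ) (L : ℝ) (hL : L ≠ 0) (n : ℕ)
    (hf : (fun e => f e - L * e ^ n) =O[nhdsWithin 0 (Set.Ioi 0)] fun e => e ^ (n+1))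
    (hg : (fun e => g e - L * e ^ n) =O[nhdsWithin 0 (Set.Ioi 0)] fun e => e ^ (n+1)) :
    Tendsto (fun e => f e / g e) (nhdsWithin 0 (Set.Ioi 0)) (nhds 1) := by
  have h := (lim_of f L n hf).div (lim_of g L n hg) hL
  rw [div_self hL] at h
  refine h.congr' ?_
  have hpos : ∀ᶠ e : ℝ in nhdsWithin 0 (Set.Ioi 0), 0 < e := self_mem_nhdsWithin
  filter_upwards [hpos] with e he
  simp only [Pi.div_apply]
  rw [div_div_div_cancel_right₀ (by positivity)]

lemma exj (m n : ℕ) (hm : 2 ≤ m) : ∃ j : ℝ → ℝ, Bd j ∧ ∀ e, 0 < e →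
    besselJ n (m * e) = e ^ n * ((m:ℝ) ^ n / (2 ^ n * n.factorial) + e ^ 2 * j e) := by
  refine ⟨fun e => (besselJ n (m * e) - (m * e) ^ n / (2 ^ n * n.factorial)) / e ^ (n+2), ?_, ?_⟩
  · apply Bd.of_le _ ((m:ℝ) ^ (n+2))
    intro e he _
    have := bj_asym n (m * e) (by positivity)
    rw [abs_div, abs_of_pos (by positivity : 0 < e ^ (n+2)), div_le_iff₀ (by positivity), ← mul_pow]
    exact this
  · intro e he
    field_simp
    ring

lemma exh : ∃ h : ℝ → ℝ, Bd h ∧ ∀ e, 0 < e → e < 1/2 →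
    1 / Real.sqrt (1 - e^2) = 1 + e ^ 2 * h e := by
  refine ⟨fun e => (1 / Real.sqrt (1 - e^2) - 1) / e ^ 2, ?_, ?_⟩
  · apply Bd.of_le _ 2
    intro e he he1
    have hpos : 0 < 1 - e^2 := by nlinarith
    have hs : Real.sqrt (1 - e^2) ^ 2 = 1 - e^2 := Real.sq_sqrt hpos.le
    have hs0 : 0 < Real.sqrt (1 - e^2) := by positivity
    generalize Real.sqrt (1 - e^2) = s at *
    have hs1 : s ≤ 1 := by nlinarith
    have hs2 : 1/2 ≤ s := by nlinarith
    have h1 : 1 ≤ 1 / s := by rw [le_div_iff₀ hs0]; linarith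
    rw [abs_of_nonneg (div_nonneg (by linarith) (by positivity)), div_le_iff₀ (by positivity),
      sub_le_iff_le_add, div_le_iff₀ hs0]
    have : e ^ 2 = 1 - s^2 := by linarith
    rw [this]
    nlinarith [mul_nonneg (sub_nonneg.2 hs1) (sub_nonneg.2 hs2), mul_nonneg (mul_nonneg (sub_nonneg.2 hs1) (sub_nonneg.2 hs2)) hs0.le]
  · intro e he _
    field_simp
    ring

lemma main_gt (n : ℕ) :
    ((fun e => deriv (coefA (n+3)) e -
          (8 * ((n+3:ℕ):ℝ) ^ (n+3) * (((n+3:ℕ):ℝ) - 1) * (((n+3:ℕ):ℝ) - 2) / (2 ^ (n+3) * (Nat.factorial (n+3)) * ((n+3:ℕ):ℝ) ^ 2))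
            * e ^ n) =O[nhdsWithin 0 (Set.Ioi 0)] fun e => e ^ (n+1)) ∧
    ((fun e => deriv (coefB (n+3)) e -
          (8 * ((n+3:ℕ):ℝ) ^ (n+3) * (((n+3:ℕ):ℝ) - 1) * (((n+3:ℕ):ℝ) - 2) / (2 ^ (n+3) * (Nat.factorial (n+3)) * ((n+3:ℕ):ℝ) ^ 2))
            * e ^ n) =O[nhdsWithin 0 (Set.Ioi 0)] fun e => e ^ (n+1)) := by
  obtain ⟨j, hj, hj'⟩ := exj (n+3) (n+3) (by omega)
  obtain ⟨k, hk, hk'⟩ := exj (n+3) (n+3+1) (by omega)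
  obtain ⟨h, hh, hh'⟩ := exh
  have dA := derivA (n+3) (by omega)
  have dB := derivB (n+3) (by omega)
  have hL : 8 * ((n+3:ℕ):ℝ) ^ (n+3) * (((n+3:ℕ):ℝ) - 1) * (((n+3:ℕ):ℝ) - 2) / (2 ^ (n+3) * (Nat.factorial (n+3)) * ((n+3:ℕ):ℝ) ^ 2)
    = 8 / ((n+3:ℕ):ℝ) ^ 2 * (((n+3:ℕ):ℝ) - 1) * (((n+3:ℕ):ℝ) - 2) * (((n+3:ℕ):ℝ) ^ (n+3) / (2 ^ (n+3) * (Nat.factorial (n+3)))) := by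
    have : ((Nat.factorial (n+3) : ℕ) : ℝ) ≠ 0 := by positivity
    field_simp
  have hcast : (((n+3+1 : ℕ)) : ℤ) = ((n+3:ℕ):ℤ) + 1 := by push_cast; ring
  rw [hcast] at hk'
  rw [hL]
  generalize ((n+3:ℕ):ℝ) ^ (n+3) / (2 ^ (n+3) * ((Nat.factorial (n+3) : ℕ) : ℝ)) = c at *
  generalize ((n+3:ℕ):ℝ) ^ (n+3+1) / (2 ^ (n+3+1) * ((Nat.factorial (n+3+1) : ℕ) : ℝ)) = c' at *
  have hM : ((n+3:ℕ):ℝ) ≠ 0 := by positivity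
  generalize ((n+3:ℕ):ℝ) = M at *
  constructor
  · apply fin_asym _ (fun e => 4 / M^2 * (e * (j e * (2 * (M-1) * (M-2)) + (c + e^2 * j e) * (2 * M^2 * e^2 - (4 * M^2 - M))
      + (c' + e^2 * k e) * (6 * M - M * e^2))))
    · repeat' first | exact Bd.const _ | exact hj | exact hk | exact Bd.id' | exact Bd.pow' _ | apply Bd.neg' | apply Bd.add' | apply Bd.sub' | apply Bd.mul'
    · intro e he he1
      rw [dA e he, hj' e he, hk' e he]
      field_simp
      ring
  · apply fin_asym _ (fun e => 8 / M^2 * (e * (h e * (M-1) * (M-2) * c + (1 + e^2 * h e) * (j e * ((M-1) * (M-2)) + (c + e^2 * j e) * (M^2 * e^2 - (2 * M^2 - 3 * M + 1))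
      - (c' + e^2 * k e) * (M^2 + 2 - e^2 * (2 * M^2 + 1) + M^2 * e^4)))))
    · repeat' first | exact Bd.const _ | exact hj | exact hk | exact hh | exact Bd.id' | exact Bd.pow' _ | apply Bd.neg' | apply Bd.add' | apply Bd.sub' | apply Bd.mul'
    · intro e he he1
      rw [dB e he (by linarith), hj' e he, hk' e he, hh' e he he1]
      field_simp
      ring

lemma main_two :
    ((fun e => deriv (coefA 2) e - (-5) * e ^ 1) =O[nhdsWithin 0 (Set.Ioi 0)] fun e => e ^ (1+1)) ∧
    ((fun e => deriv (coefB 2) e - (-5) * e ^ 1) =O[nhdsWithin 0 (Set.Ioi 0)] fun e => e ^ (1+1)) := by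
  obtain ⟨j, hj, hj'⟩ := exj 2 2 (by omega)
  obtain ⟨k, hk, hk'⟩ := exj 2 3 (by omega)
  obtain ⟨h, hh, hh'⟩ := exh
  have dA := derivA 2 (by omega)
  have dB := derivB 2 (by omega)
  norm_num [Nat.factorial] at hj' hk' dA dB
  constructor
  · apply fin_asym _ (fun e => e * (j e * (-14) + (1/2 + e^2 * j e) * 8
      + (k e * 12 - 2 * (1/6 + e^2 * k e))))
    · repeat' first | exact Bd.const _ | exact hj | exact hk | exact Bd.id' | exact Bd.pow' _ | apply Bd.neg' | apply Bd.add' | apply Bd.sub' | apply Bd.mul'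
    · intro e he he1
      rw [dA e he, hj' e he, hk' e he]
      field_simp
      ring
  · apply fin_asym _ (fun e => e * (h e * (-5) + (1 + e^2 * h e) * 2 * (j e * (-3) + (1/2 + e^2 * j e) * 4
      - (k e * 6) - (1/6 + e^2 * k e) * (4 * e^2 - 9))))
    · repeat' first | exact Bd.const _ | exact hj | exact hk | exact hh | exact Bd.id' | exact Bd.pow' _ | apply Bd.neg' | apply Bd.add' | apply Bd.sub' | apply Bd.mul'
    · intro e he he1
      have h1 := hh' e he he1
      rw [one_div] at h1
      rw [dB e he (by linarith), hj' e he, hk' e he, h1]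
      field_simp
      ring

/-- For every integer `m ≥ 2`, `A_m'(e)/B_m'(e) → 1` as `e → 0⁺`; indeed both `A_m'` and
`B_m'` have common leading Taylor behavior `−5e + O(e²)` when `m = 2` and
`(8m^m(m−1)(m−2)/(2^m m! m²))e^{m−3} + O(e^{m−2})` when `m > 2`. -/
theorem stmt_13 (m : ℕ) (hm : 2 ≤ m) :
    Tendsto (fun e => deriv (coefA m) e / deriv (coefB m) e) (nhdsWithin 0 (Set.Ioi 0))
      (nhds 1) ∧
    (m = 2 →
      ((fun e => deriv (coefA 2) e - (-5 * e)) =O[nhdsWithin 0 (Set.Ioi 0)] fun e => e ^ 2) ∧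
      ((fun e => deriv (coefB 2) e - (-5 * e)) =O[nhdsWithin 0 (Set.Ioi 0)] fun e => e ^ 2)) ∧
    (2 < m →
      ((fun e => deriv (coefA m) e -
          (8 * (m:ℝ) ^ m * ((m:ℝ) - 1) * ((m:ℝ) - 2) / (2 ^ m * (Nat.factorial m) * (m:ℝ) ^ 2))
            * e ^ (m - 3)) =O[nhdsWithin 0 (Set.Ioi 0)] fun e => e ^ (m - 2)) ∧
      ((fun e => deriv (coefB m) e -
          (8 * (m:ℝ) ^ m * ((m:ℝ) - 1) * ((m:ℝ) - 2) / (2 ^ m * (Nat.factorial m) * (m:ℝ) ^ 2))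
            * e ^ (m - 3)) =O[nhdsWithin 0 (Set.Ioi 0)] fun e => e ^ (m - 2))) := by 
  rcases Nat.lt_or_ge 2 m with h | h
  · obtain ⟨n, rfl⟩ : ∃ n, m = n + 3 := ⟨m - 3, by omega⟩
    obtain ⟨hA, hB⟩ := main_gt n
    refine ⟨ratio_of _ _ _ ?_ n hA hB, fun h2 => by omega, fun _ => ⟨hA, hB⟩⟩
    have h1 : (((n+3:ℕ):ℝ) - 1) ≠ 0 := by have : (0:ℝ) ≤ n := Nat.cast_nonneg n; push_cast; intro h; linarith
    have h2 : (((n+3:ℕ):ℝ) - 2) ≠ 0 := by have : (0:ℝ) ≤ n := Nat.cast_nonneg n; push_cast; intro h; linarith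
    positivity
  · obtain rfl : m = 2 := le_antisymm h hm
    obtain ⟨hA, hB⟩ := main_two
    refine ⟨ratio_of _ _ (-5) (by norm_num) 1 hA hB, fun _ => ?_, fun h2 => by omega⟩
    simp only [pow_one] at hA hB
    exact ⟨hA, hB⟩
end

section
/- For every real κ with −1 ≤ κ < 1, the function e ↦ B₁'(e) − κ·A₁'(e) has at least one zero in the interval 0 < e < 1. (This rests on the facts that B₁'(e) → −3 and A₁'(e) → −3 as e → 0⁺, that B₁'(e) → +∞ as e → 1⁻, and that A₁' has a finite limit as e → 1⁻.) -/
open Real Set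

noncomputable def auxD (x : ℝ) : ℝ :=
  (1 / (2 * π)) * ∫ t in (0:ℝ)..(2 * π), Real.sin t * Real.sin (t - x * Real.sin t)

noncomputable def auxDD (x : ℝ) : ℝ :=
  (1 / (2 * π)) * ∫ t in (0:ℝ)..(2 * π), -(Real.sin t) ^ 2 * Real.cos (t - x * Real.sin t)

lemma hasDeriv_param (f f' : ℝ → ℝ → ℝ) (x : ℝ)
    (hf : ∀ x, Continuous (f x)) (hf' : ∀ x, Continuous (f' x))
    (hb : ∀ x t, |f' x t| ≤ 1) (hd : ∀ x t, HasDerivAt (fun y => f y t) (f' x t) x) :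
    HasDerivAt (fun y => (1 / (2 * π)) * ∫ t in (0:ℝ)..(2 * π), f y t)
      ((1 / (2 * π)) * ∫ t in (0:ℝ)..(2 * π), f' x t) x := by
  have := (intervalIntegral.hasDerivAt_integral_of_dominated_loc_of_deriv_le
    (μ := MeasureTheory.volume) (a := 0) (b := 2 * π)
    (F := f) (F' := f') (x₀ := x) (s := Set.univ) (bound := fun _ => 1) Filter.univ_mem
    (Filter.Eventually.of_forall fun y => (hf y).aestronglyMeasurable)
    ((hf x).intervalIntegrable _ _) (hf' x).aestronglyMeasurable
    (Filter.Eventually.of_forall fun t _ y _ => by simpa using hb y t)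
    (by simp)
    (Filter.Eventually.of_forall fun t _ y _ => hd y t)).2
  exact this.const_mul _

lemma abs_ss (a b : ℝ) : |Real.sin a * Real.sin b| ≤ 1 := by
  rw [abs_mul]
  exact mul_le_one₀ (Real.abs_sin_le_one _) (abs_nonneg _) (Real.abs_sin_le_one _)

lemma hasDeriv_J (x : ℝ) : HasDerivAt (besselJ 1) (auxD x) x := by
  have h := hasDeriv_param (fun x t => Real.cos (((1:ℤ):ℝ) * t - x * Real.sin t))
    (fun x t => Real.sin t * Real.sin (t - x * Real.sin t)) x
    (fun x => by fun_prop) (fun x => by fun_prop) (fun x t => abs_ss _ _)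
    (fun x t => by
      have h1 : HasDerivAt (fun y : ℝ => ((1:ℤ):ℝ) * t - y * Real.sin t) (-(1 * Real.sin t)) x :=
        ((hasDerivAt_id x).mul_const (Real.sin t)).const_sub _
      have h2 := h1.cos
      convert h2 using 1
      push_cast; ring_nf)
  exact h

lemma hasDeriv_D (x : ℝ) : HasDerivAt auxD (auxDD x) x := by
  have h := hasDeriv_param (fun x t => Real.sin t * Real.sin (t - x * Real.sin t))
    (fun x t => -(Real.sin t) ^ 2 * Real.cos (t - x * Real.sin t)) x
    (fun x => by fun_prop) (fun x => by fun_prop) (fun x t => by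
      rw [abs_mul]
      refine mul_le_one₀ ?_ (abs_nonneg _) (Real.abs_cos_le_one _)
      rw [abs_neg, abs_of_nonneg (sq_nonneg _)]
      exact Real.sin_sq_le_one t)
    (fun x t => by
      have h1 : HasDerivAt (fun y : ℝ => t - y * Real.sin t) (-(1 * Real.sin t)) x :=
        ((hasDerivAt_id x).mul_const (Real.sin t)).const_sub _
      have h2 := h1.sin.const_mul (Real.sin t)
      exact h2.congr_deriv (by ring))
  exact h

lemma Jd_eq : besselJd 1 = auxD := funext fun x => (hasDeriv_J x).deriv

lemma diff_J : Differentiable ℝ (besselJ 1) := fun x => (hasDeriv_J x).differentiableAt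
lemma diff_D : Differentiable ℝ auxD := fun x => (hasDeriv_D x).differentiableAt

lemma hd_s2 (t : ℝ) : HasDerivAt (fun t => t / 2 - Real.sin t * Real.cos t / 2)
    (Real.sin t ^ 2) t := by
  have h := ((hasDerivAt_id t).div_const 2).sub
    (((Real.hasDerivAt_sin t).mul (Real.hasDerivAt_cos t)).div_const 2)
  refine h.congr_deriv ?_
  linear_combination (-1 / 2 : ℝ) * Real.sin_sq_add_cos_sq t

lemma hd_s4 (t : ℝ) : HasDerivAt
    (fun t => 3 * t / 8 - 3 / 8 * (Real.sin t * Real.cos t) - Real.sin t ^ 3 * Real.cos t / 4)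
    (Real.sin t ^ 4) t := by
  have h := ((((hasDerivAt_id t).const_mul 3).div_const 8).sub
    (((Real.hasDerivAt_sin t).mul (Real.hasDerivAt_cos t)).const_mul (3 / 8))).sub
    ((((Real.hasDerivAt_sin t).pow 3).mul (Real.hasDerivAt_cos t)).div_const 4)
  refine h.congr_deriv ?_
  have := Real.cos_sq' t
  simp
  linear_combination (-3 / 8 - 3 / 4 * Real.sin t ^ 2 : ℝ) * this

lemma main_bound (f g G : ℝ → ℝ) (v C : ℝ) (hf : Continuous f) (hg : Continuous g)
    (hG : ∀ t, HasDerivAt G (g t) t) (hv : G (2 * π) - G 0 = 2 * π * v)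
    (hb : ∀ t, |f t - g t| ≤ C) :
    |(1 / (2 * π)) * (∫ t in (0:ℝ)..(2 * π), f t) - v| ≤ C := by
  have hp := Real.pi_pos
  have hI : ∫ t in (0:ℝ)..(2 * π), g t = 2 * π * v := by
    rw [intervalIntegral.integral_eq_sub_of_hasDerivAt (fun t _ => hG t)
      (hg.intervalIntegrable _ _), hv]
  have h1 : (1 / (2 * π)) * (∫ t in (0:ℝ)..(2 * π), f t) - v
      = (1 / (2 * π)) * ∫ t in (0:ℝ)..(2 * π), (f t - g t) := by
    rw [intervalIntegral.integral_sub (hf.intervalIntegrable _ _) (hg.intervalIntegrable _ _), hI]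
    field_simp
  have h2 := intervalIntegral.norm_integral_le_of_norm_le_const (a := 0) (b := 2 * π)
    (f := fun t => f t - g t) (C := C) (fun t _ => hb t)
  rw [h1, abs_mul, abs_of_pos (by positivity)]
  rw [Real.norm_eq_abs, sub_zero, abs_of_pos (by positivity : 0 < 2 * π)] at h2
  calc _ ≤ 1 / (2 * π) * (C * (2 * π)) := by gcongr
    _ = C := by field_simp

lemma trig_err (x t : ℝ) (hx : |x| ≤ 1) :
    |Real.cos (x * Real.sin t) - (1 - (x * Real.sin t) ^ 2 / 2)| ≤ |x| ^ 4 * (5 / 96) ∧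
    |Real.sin (x * Real.sin t) - (x * Real.sin t - (x * Real.sin t) ^ 3 / 6)|
      ≤ |x| ^ 4 * (5 / 96) := by
  have h0 : |x * Real.sin t| ≤ |x| := by
    rw [abs_mul]; exact mul_le_of_le_one_right (abs_nonneg _) (Real.abs_sin_le_one _)
  have h4 : |x * Real.sin t| ^ 4 * (5 / 96) ≤ |x| ^ 4 * (5 / 96) := by gcongr
  refine ⟨(Real.cos_bound (h0.trans hx)).trans h4, (Real.sin_bound (h0.trans hx)).trans ?_⟩
  have h5 : |x * Real.sin t| ^ 5 ≤ |x| ^ 4 := by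
    calc |x * Real.sin t| ^ 5 ≤ |x| ^ 5 := by gcongr
      _ ≤ |x| ^ 4 := pow_le_pow_of_le_one (abs_nonneg _) hx (by norm_num)
  have : 0 ≤ |x| ^ 4 := by positivity
  linarith

lemma comb (a b u v C : ℝ) (ha : |a| ≤ 1) (hb : |b| ≤ 1) (hu : |u| ≤ C) (hv : |v| ≤ C) :
    |a * u + b * v| ≤ 2 * C := by
  refine (abs_add_le _ _).trans ?_
  rw [abs_mul, abs_mul]
  nlinarith [abs_nonneg a, abs_nonneg b, abs_nonneg u, abs_nonneg v]

lemma J_bound (x : ℝ) (hx : |x| ≤ 1) :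
    |besselJ 1 x - (x / 2 - x ^ 3 / 16)| ≤ 2 * (|x| ^ 4 * (5 / 96)) := by
  unfold besselJ
  refine main_bound _ (fun t => Real.cos t - x ^ 2 / 2 * (Real.sin t ^ 2 * Real.cos t)
      + x * Real.sin t ^ 2 - x ^ 3 / 6 * Real.sin t ^ 4)
    (fun t => Real.sin t - x ^ 2 / 2 * (Real.sin t ^ 3 / 3)
      + x * (t / 2 - Real.sin t * Real.cos t / 2) - x ^ 3 / 6 *
      (3 * t / 8 - 3 / 8 * (Real.sin t * Real.cos t) - Real.sin t ^ 3 * Real.cos t / 4))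
    _ _ (by fun_prop) (by fun_prop) ?_ ?_ ?_
  · intro t
    have h := (((Real.hasDerivAt_sin t).sub
      ((((Real.hasDerivAt_sin t).pow 3).div_const 3).const_mul (x ^ 2 / 2))).add
      ((hd_s2 t).const_mul x)).sub ((hd_s4 t).const_mul (x ^ 3 / 6))
    refine h.congr_deriv ?_
    push_cast; norm_num; ring_nf; try simp
  · simp; ring
  · intro t
    obtain ⟨h1, h2⟩ := trig_err x t hx
    have h3 := comb _ _ _ _ _ (Real.abs_cos_le_one t) (Real.abs_sin_le_one t) h1 h2
    convert h3 using 2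
    push_cast
    rw [one_mul, Real.cos_sub]
    ring

lemma D_bound (x : ℝ) (hx : |x| ≤ 1) :
    |auxD x - (1 / 2 - 3 * x ^ 2 / 16)| ≤ 2 * (|x| ^ 4 * (5 / 96)) := by
  unfold auxD
  refine main_bound _ (fun t => Real.sin t ^ 2 - x ^ 2 / 2 * Real.sin t ^ 4
      - x * (Real.sin t ^ 2 * Real.cos t) + x ^ 3 / 6 * (Real.sin t ^ 4 * Real.cos t))
    (fun t => (t / 2 - Real.sin t * Real.cos t / 2) - x ^ 2 / 2 *
      (3 * t / 8 - 3 / 8 * (Real.sin t * Real.cos t) - Real.sin t ^ 3 * Real.cos t / 4)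
      - x * (Real.sin t ^ 3 / 3) + x ^ 3 / 6 * (Real.sin t ^ 5 / 5))
    _ _ (by fun_prop) (by fun_prop) ?_ ?_ ?_
  · intro t
    have h := (((hd_s2 t).sub ((hd_s4 t).const_mul (x ^ 2 / 2))).sub
      ((((Real.hasDerivAt_sin t).pow 3).div_const 3).const_mul x)).add
      ((((Real.hasDerivAt_sin t).pow 5).div_const 5).const_mul (x ^ 3 / 6))
    refine h.congr_deriv ?_
    simp; ring
  · simp; ring
  · intro t
    obtain ⟨h1, h2⟩ := trig_err x t hx
    have h3 := comb (Real.sin t * Real.sin t) (-(Real.sin t * Real.cos t)) _ _ _ (abs_ss t t)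
      (by
        rw [abs_neg, abs_mul]
        exact mul_le_one₀ (Real.abs_sin_le_one _) (abs_nonneg _) (Real.abs_cos_le_one _)) h1 h2
    convert h3 using 2
    rw [Real.sin_sub]
    ring

lemma D_one_pos : 0 < auxD 1 := by
  have h := abs_le.1 (D_bound 1 (by simp))
  norm_num at h
  linarith [h.1]

open Filter Topology

lemma small_lim (f : ℝ → ℝ) (n : ℕ) (hn : n < 4)
    (h : ∀ x, |x| ≤ 1 → |f x| ≤ 2 * (|x| ^ 4 * (5 / 96))) :
    Tendsto (fun x => f x / x ^ n) (𝓝[≠] 0) (𝓝 0) := by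
  have hl : Tendsto (fun x : ℝ => |x|) (𝓝[≠] 0) (𝓝 0) := by
    have : Tendsto (fun x : ℝ => |x|) (𝓝 0) (𝓝 |0|) := continuous_abs.tendsto 0
    rw [abs_zero] at this
    exact this.mono_left nhdsWithin_le_nhds
  refine squeeze_zero_norm' ?_ hl
  have h1 : ∀ᶠ x : ℝ in 𝓝[≠] 0, |x| ≤ 1 := hl.eventually (ge_mem_nhds one_pos)
  filter_upwards [h1, self_mem_nhdsWithin] with x hx hx0
  have hp : 0 < |x| := abs_pos.2 hx0
  rw [Real.norm_eq_abs, abs_div, abs_pow, div_le_iff₀ (by positivity), ← pow_succ']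
  have h2 : |x| ^ 4 ≤ |x| ^ (n + 1) := pow_le_pow_of_le_one hp.le hx (by omega)
  have := h x hx
  nlinarith [pow_pos hp 4]

lemma coefA_eq (e : ℝ) : coefA 1 e =
    (4 / e ^ 2) * (2 * e * (1 - e ^ 2) * auxD e - (2 - e ^ 2) * besselJ 1 e) := by
  simp [coefA, Jd_eq]

lemma coefB_eq (e : ℝ) : coefB 1 e =
    -(8 / e ^ 2) * Real.sqrt (1 - e ^ 2) * (e * auxD e - (1 - e ^ 2) * besselJ 1 e) := by
  simp [coefB, Jd_eq]

lemma diffA (e : ℝ) (he : e ≠ 0) : DifferentiableAt ℝ (coefA 1) e := by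
  rw [funext coefA_eq]
  have := diff_J e
  have := diff_D e
  have : e ^ 2 ≠ 0 := by positivity
  fun_prop (disch := assumption)

lemma diffB (e : ℝ) (he : e ≠ 0) (h1 : 1 - e ^ 2 ≠ 0) : DifferentiableAt ℝ (coefB 1) e := by
  rw [funext coefB_eq]
  have := diff_J e
  have := diff_D e
  have : e ^ 2 ≠ 0 := by positivity
  fun_prop (disch := assumption)

lemma contB (e : ℝ) (he : e ≠ 0) : ContinuousAt (coefB 1) e := by
  rw [funext coefB_eq]
  have := (diff_J e).continuousAt
  have := (diff_D e).continuousAt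
  have : e ^ 2 ≠ 0 := by positivity
  fun_prop (disch := assumption)

lemma derivF_zero (κ : ℝ) :
    HasDerivAt (fun e => coefB 1 e - κ * coefA 1 e) (3 * κ - 3) 0 := by
  rw [hasDerivAt_iff_tendsto_slope]
  have hp := small_lim (fun x => besselJ 1 x - (x / 2 - x ^ 3 / 16)) 3 (by norm_num) J_bound
  have hq := small_lim (fun x => auxD x - (1 / 2 - 3 * x ^ 2 / 16)) 2 (by norm_num) D_bound
  have hx : Tendsto (fun x : ℝ => x) (𝓝[≠] 0) (𝓝 0) := tendsto_id.mono_left nhdsWithin_le_nhds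
  have hs : Tendsto (fun x : ℝ => Real.sqrt (1 - x ^ 2)) (𝓝[≠] 0) (𝓝 1) := by
    have : Tendsto (fun x : ℝ => Real.sqrt (1 - x ^ 2)) (𝓝 0) (𝓝 (Real.sqrt (1 - 0 ^ 2))) :=
      Continuous.tendsto (by fun_prop) 0
    simp only [ne_eq, OfNat.ofNat_ne_zero, not_false_eq_true, zero_pow, sub_zero,
      Real.sqrt_one] at this
    exact this.mono_left nhdsWithin_le_nhds
  have hx2 := hx.pow 2
  have hB := (hs.const_mul (-8)).mul
    (((hq.const_add (3 / 8)).sub (hx2.div_const 16)).sub ((hx2.const_sub 1).mul hp))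
  have hA := ((((hx2.mul_const (5 / 16)).add_const (-3 / 4)).add
    (((hx2.const_sub 1).const_mul 2).mul hq)).sub ((hx2.const_sub 2).mul hp)).const_mul 4
  have h := hB.sub (hA.const_mul κ)
  have e : 3 * κ - 3 = -8 * 1 * (3 / 8 + 0 - 0 ^ 2 / 16 - (1 - 0 ^ 2) * 0) -
     κ * (4 * (0 ^ 2 * (5 / 16) + -3 / 4 + 2 * (1 - 0 ^ 2) * 0 - (2 - 0 ^ 2) * 0)) := by ring
  rw [e]
  refine h.congr' ?_
  filter_upwards [self_mem_nhdsWithin] with x hx0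
  have hx0 : x ≠ 0 := hx0
  simp only [slope_def_field, coefA_eq, coefB_eq]
  simp
  field_simp
  ring

lemma near_one (κ : ℝ) : ∃ e ∈ Set.Ioo (0:ℝ) 1,
    coefB 1 e - κ * coefA 1 e < coefB 1 1 - κ * coefA 1 1 := by
  let H : ℝ → ℝ := fun e => -(8 / e ^ 2) * (e * auxD e - (1 - e ^ 2) * besselJ 1 e)
    + κ * dslope (coefA 1) 1 e * (Real.sqrt (1 - e ^ 2) / (1 + e))
  have hH : ContinuousAt H 1 := by
    have h1 : ContinuousAt (dslope (coefA 1) 1) 1 :=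
      continuousAt_dslope_same.2 (diffA 1 one_ne_zero)
    have := (diff_J 1).continuousAt
    have := (diff_D 1).continuousAt
    have : (1:ℝ) ^ 2 ≠ 0 := by norm_num
    have : (1:ℝ) + 1 ≠ 0 := by norm_num
    fun_prop (disch := assumption)
  have hneg : H 1 < 0 := by
    have := D_one_pos
    simp [H]; linarith
  have hev : ∀ᶠ e in 𝓝[<] (1:ℝ), H e < 0 :=
    (hH.eventually_lt continuousAt_const hneg).filter_mono nhdsWithin_le_nhds
  have hI : ∀ᶠ e in 𝓝[<] (1:ℝ), e ∈ Set.Ioo (0:ℝ) 1 := Ioo_mem_nhdsLT one_pos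
  obtain ⟨e, he, hI⟩ := (hev.and hI).exists
  refine ⟨e, hI, ?_⟩
  have h0 : 0 < 1 - e ^ 2 := by nlinarith [hI.1, hI.2]
  have hs : 0 < Real.sqrt (1 - e ^ 2) := Real.sqrt_pos.2 h0
  have hss : Real.sqrt (1 - e ^ 2) ^ 2 = 1 - e ^ 2 := Real.sq_sqrt h0.le
  have hA : coefA 1 e - coefA 1 1 = (e - 1) * dslope (coefA 1) 1 e := by
    have := sub_smul_dslope (coefA 1) 1 e
    rw [smul_eq_mul] at this
    exact this.symm
  have hB1 : coefB 1 1 = 0 := by simp [coefB_eq]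
  have key : coefB 1 e - κ * (coefA 1 e - coefA 1 1) = Real.sqrt (1 - e ^ 2) * H e := by
    rw [hA, coefB_eq]
    have h1e : 1 + e ≠ 0 := by linarith [hI.1]
    have h3 : Real.sqrt (1 - e ^ 2) * (Real.sqrt (1 - e ^ 2) / (1 + e)) = 1 - e := by
      rw [← mul_div_assoc, ← sq, hss]; field_simp; ring
    simp only [H]
    linear_combination (-κ * dslope (coefA 1) 1 e) * h3
  have := mul_neg_of_pos_of_neg hs he
  rw [hB1]
  linarith

/-- For every real `κ` with `−1 ≤ κ < 1`, the function `e ↦ B₁'(e) − κ·A₁'(e)` has at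
least one zero in `(0,1)`. -/
theorem stmt_14 (κ : ℝ) (hκ₁ : -1 ≤ κ) (hκ₂ : κ < 1) :
    ∃ e ∈ Set.Ioo (0:ℝ) 1, deriv (coefB 1) e - κ * deriv (coefA 1) e = 0 := by
  have hd := derivF_zero κ
  obtain ⟨e₁, he₁, hlt₁⟩ := near_one κ
  obtain ⟨e₀, he₀, hlt₀⟩ : ∃ e ∈ Set.Ioo (0:ℝ) 1,
      coefB 1 e - κ * coefA 1 e < coefB 1 0 - κ * coefA 1 0 := by
    have h := hasDerivAt_iff_tendsto_slope.1 hd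
    have h1 : ∀ᶠ e in 𝓝[>] (0:ℝ), slope (fun e => coefB 1 e - κ * coefA 1 e) 0 e < 0 :=
      (h.eventually (gt_mem_nhds (by linarith))).filter_mono
        (nhdsWithin_mono _ fun x hx => ne_of_gt hx)
    have hI : ∀ᶠ e in 𝓝[>] (0:ℝ), e ∈ Set.Ioo (0:ℝ) 1 := Ioo_mem_nhdsGT one_pos
    obtain ⟨e, he, hI⟩ := (h1.and hI).exists
    refine ⟨e, hI, ?_⟩
    rw [slope_def_field, sub_zero, div_lt_iff₀ hI.1] at he
    linarith
  have hc : ContinuousOn (fun e => coefB 1 e - κ * coefA 1 e) (Set.Icc 0 1) := by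
    intro e _
    apply ContinuousAt.continuousWithinAt
    by_cases h : e = 0
    · rw [h]; exact hd.continuousAt
    · exact (contB e h).sub ((diffA e h).continuousAt.const_mul κ)
  obtain ⟨m, hm, hmin⟩ := isCompact_Icc.exists_isMinOn (Set.nonempty_Icc.2 zero_le_one) hc
  have hm0 : m ≠ 0 := by
    rintro rfl
    have := isMinOn_iff.1 hmin e₀ (Set.Ioo_subset_Icc_self he₀)
    linarith
  have hm1 : m ≠ 1 := by
    rintro rfl
    have := isMinOn_iff.1 hmin e₁ (Set.Ioo_subset_Icc_self he₁)
    linarith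
  have hmI : m ∈ Set.Ioo (0:ℝ) 1 := ⟨lt_of_le_of_ne hm.1 hm0.symm, lt_of_le_of_ne hm.2 hm1⟩
  refine ⟨m, hmI, ?_⟩
  have h := (hmin.isLocalMin (Icc_mem_nhds hmI.1 hmI.2)).deriv_eq_zero
  have hA := diffA m hm0
  have hB := diffB m hm0 (by nlinarith [hmI.1, hmI.2])
  have h2 := (hB.hasDerivAt.sub (hA.hasDerivAt.const_mul κ)).deriv
  rw [← h2]
  exact h
end
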